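/- Let γ* be the unique maximizer of the Q-entropy H_q on the set Γ of queenons. Then −1.9449 ≤ H_q(γ*) ≤ −1.94. -/

import Mathlib

open MeasureTheory Filter Topology
open scoped ENNReal

noncomputable section

/-- The square `[-1/2,1/2]²`. -/
def unitSq : Set (ℝ × ℝ) :=
  Set.Icc (-(1:ℝ)/2) (1/2) ×ˢ Set.Icc (-(1:ℝ)/2) (1/2)

/-- The square `σ_{i,j}^N` (for `i, j ∈ [N]`). -/
def gridSq (N i j : ℕ) : Set (ℝ × ℝ) :=
  Set.Icc (-(1:ℝ)/2 + ((i:ℝ) - 1)/N) (-(1:ℝ)/2 + (i:ℝ)/N) ×ˢ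
    Set.Icc (-(1:ℝ)/2 + ((j:ℝ) - 1)/N) (-(1:ℝ)/2 + (j:ℝ)/N)

/-- The cell of the partition `I_N` with index `i, j ∈ [2N]`. -/
def INcell (N i j : ℕ) : Set (ℝ × ℝ) :=
  {p ∈ unitSq | (-1 + ((i:ℝ) - 1)/N ≤ p.1 + p.2 ∧ p.1 + p.2 ≤ -1 + (i:ℝ)/N) ∧
    (-1 + ((j:ℝ) - 1)/N ≤ p.2 - p.1 ∧ p.2 - p.1 ≤ -1 + (j:ℝ)/N)}

/-- The interval of the partition `J_N` of `[-1,1]` with index `i ∈ [2N]`. -/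
def JNcell (N i : ℕ) : Set ℝ :=
  Set.Icc (-1 + ((i:ℝ) - 1)/N) (-1 + (i:ℝ)/N)

/-- A member of the family `R` of subsets of the square. -/
def Rset (a₁ b₁ a₂ b₂ : ℝ) : Set (ℝ × ℝ) :=
  {p ∈ unitSq | (a₁ ≤ p.1 + p.2 ∧ p.1 + p.2 ≤ b₁) ∧ (a₂ ≤ p.2 - p.1 ∧ p.2 - p.1 ≤ b₂)}

/-- The distance `d` between two Borel measures on the square: the supremum of
`|γ₁(α) − γ₂(α)|` over `α ∈ R`. -/
def qdist (μ ν : Measure (ℝ × ℝ)) : ℝ :=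
  sSup {t : ℝ | ∃ a₁ b₁ a₂ b₂ : ℝ, a₁ ∈ Set.Icc (-1:ℝ) 1 ∧ b₁ ∈ Set.Icc (-1:ℝ) 1 ∧
    a₂ ∈ Set.Icc (-1:ℝ) 1 ∧ b₂ ∈ Set.Icc (-1:ℝ) 1 ∧
    t = |(μ (Rset a₁ b₁ a₂ b₂)).toReal - (ν (Rset a₁ b₁ a₂ b₂)).toReal|}

/-- A permuton: a Borel probability measure on the square with uniform marginals. -/
def IsPermuton (μ : Measure (ℝ × ℝ)) : Prop :=
  IsProbabilityMeasure μ ∧ μ unitSqᶜ = 0 ∧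
  ∀ a b : ℝ, -(1:ℝ)/2 ≤ a → a ≤ b → b ≤ 1/2 →
    μ (Set.Icc a b ×ˢ Set.Icc (-(1:ℝ)/2) (1/2)) = ENNReal.ofReal (b - a) ∧
    μ (Set.Icc (-(1:ℝ)/2) (1/2) ×ˢ Set.Icc a b) = ENNReal.ofReal (b - a)

/-- An `N`-step permuton: a permuton with constant density on each square `σ_{i,j}^N`. -/
def IsStepPermutonN (N : ℕ) (μ : Measure (ℝ × ℝ)) : Prop :=
  IsPermuton μ ∧
  ∀ i ∈ Finset.Icc 1 N, ∀ j ∈ Finset.Icc 1 N, ∃ c : ℝ≥0∞,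
    ∀ s : Set (ℝ × ℝ), s ⊆ gridSq N i j → MeasurableSet s → μ s = c * volume s

/-- A step permuton. -/
def IsStepPermuton (μ : Measure (ℝ × ℝ)) : Prop :=
  ∃ N : ℕ, 0 < N ∧ IsStepPermutonN N μ

/-- Sub-uniform diagonal marginals. -/
def SubUniformDiag (μ : Measure (ℝ × ℝ)) : Prop :=
  ∀ a b : ℝ, -1 ≤ a → a ≤ b → b ≤ 1 →
    μ {p ∈ unitSq | a ≤ p.1 + p.2 ∧ p.1 + p.2 ≤ b} ≤ ENNReal.ofReal (b - a) ∧
    μ {p ∈ unitSq | a ≤ p.2 - p.1 ∧ p.2 - p.1 ≤ b} ≤ ENNReal.ofReal (b - a)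

/-- The set `Γ` of queenons: the closure, in the topology of weak convergence of Borel
probability measures, of the set of step permutons with sub-uniform diagonal marginals. -/
def queenons : Set (ProbabilityMeasure (ℝ × ℝ)) :=
  closure {μ : ProbabilityMeasure (ℝ × ℝ) |
    IsStepPermuton μ.toMeasure ∧ SubUniformDiag μ.toMeasure}

/-- The pushforward `γ⁺` of `γ` under `(x,y) ↦ x+y`. -/
def diagPlus (γ : Measure (ℝ × ℝ)) : Measure ℝ := γ.map fun p => p.1 + p.2

/-- The pushforward `γ⁻` of `γ` under `(x,y) ↦ y−x`. -/
def diagMinus (γ : Measure (ℝ × ℝ)) : Measure ℝ := γ.map fun p => p.2 - p.1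

/-- The measure `γ̄⁺` on `[-1,1]`, with `γ̄⁺([a,b]) = (b−a) − γ⁺([a,b])`. -/
def barPlus (γ : Measure (ℝ × ℝ)) : Measure ℝ :=
  volume.restrict (Set.Icc (-1:ℝ) 1) - diagPlus γ

/-- The measure `γ̄⁻` on `[-1,1]`, with `γ̄⁻([a,b]) = (b−a) − γ⁻([a,b])`. -/
def barMinus (γ : Measure (ℝ × ℝ)) : Measure ℝ :=
  volume.restrict (Set.Icc (-1:ℝ) 1) - diagMinus γ

/-- The uniform probability measure on `[-1,1]` (density `1/2`). -/
def unif11 : Measure ℝ := (2 : ℝ≥0∞)⁻¹ • volume.restrict (Set.Icc (-1:ℝ) 1)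

open Classical in
/-- The Kullback–Leibler divergence of `μ` with respect to `ν`, as an extended real:
`∫ log (dμ/dν) dμ` if `μ ≪ ν` and the integrand is integrable, and `+∞` otherwise. -/
def DKL {X : Type*} [MeasurableSpace X] (μ ν : Measure X) : EReal :=
  if μ ≪ ν ∧ Integrable (fun x => Real.log (μ.rnDeriv ν x).toReal) μ then
    ((∫ x, Real.log (μ.rnDeriv ν x).toReal ∂μ : ℝ) : EReal)
  else ⊤

/-- The Q-entropy `H_q(γ) = −D_KL(γ) − D_KL(γ̄⁺) − D_KL(γ̄⁻) + 2 log 2 − 3`. -/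
def Hq (γ : Measure (ℝ × ℝ)) : EReal :=
  -DKL γ (volume.restrict unitSq) - DKL (barPlus γ) unif11 - DKL (barMinus γ) unif11
    + ((2 * Real.log 2 - 3 : ℝ) : EReal)

/-- The discrete approximation `H_q^N` of the Q-entropy. -/
def HqN (N : ℕ) (γ : Measure (ℝ × ℝ)) : ℝ :=
  -(∑ i ∈ Finset.Icc 1 (2*N), ∑ j ∈ Finset.Icc 1 (2*N),
      (γ (INcell N i j)).toReal *
        Real.log ((γ (INcell N i j)).toReal / (volume (INcell N i j)).toReal))
  - (∑ i ∈ Finset.Icc 1 (2*N),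
      (barPlus γ (JNcell N i)).toReal *
        Real.log ((2*N : ℝ) * (barPlus γ (JNcell N i)).toReal))
  - (∑ i ∈ Finset.Icc 1 (2*N),
      (barMinus γ (JNcell N i)).toReal *
        Real.log ((2*N : ℝ) * (barMinus γ (JNcell N i)).toReal))
  + 2 * Real.log 2 - 3

/-- An `n`-queens configuration: a subset of `[n]² = {1,…,n}²` with exactly one element in
each row and column and at most one element in each plus- and minus-diagonal. -/
def IsQueensConfig (n : ℕ) (q : Finset (ℕ × ℕ)) : Prop :=
  (∀ p ∈ q, p.1 ∈ Finset.Icc 1 n ∧ p.2 ∈ Finset.Icc 1 n) ∧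
  (∀ y ∈ Finset.Icc 1 n, ∃! x : ℕ, (x, y) ∈ q) ∧
  (∀ x ∈ Finset.Icc 1 n, ∃! y : ℕ, (x, y) ∈ q) ∧
  (∀ p ∈ q, ∀ p' ∈ q, p.1 + p.2 = p'.1 + p'.2 → p = p') ∧
  (∀ p ∈ q, ∀ p' ∈ q, (p.2 : ℤ) - (p.1 : ℤ) = (p'.2 : ℤ) - (p'.1 : ℤ) → p = p')

/-- `Q(n)`, the number of `n`-queens configurations. -/
def numQueens (n : ℕ) : ℕ :=
  Set.ncard {q : Finset (ℕ × ℕ) | IsQueensConfig n q}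

/-- The measure `γ_q` associated to an `n`-queens configuration `q`: density `n` on each
square `σ_{i,j}^n` with `(i,j) ∈ q`, and `0` elsewhere. -/
def gammaOf (n : ℕ) (q : Finset (ℕ × ℕ)) : Measure (ℝ × ℝ) :=
  volume.withDensity ((⋃ ij ∈ q, gridSq n ij.1 ij.2).indicator fun _ => (n : ℝ≥0∞))

/-- The set `B_n(γ,ε)` of `n`-queens configurations `q` with `d(γ_q, γ) < ε`. -/
def Bset (n : ℕ) (γ : Measure (ℝ × ℝ)) (ε : ℝ) : Set (Finset (ℕ × ℕ)) :=
  {q | IsQueensConfig n q ∧ qdist (gammaOf n q) γ < ε}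

/-- `|B_n(γ,ε)|`. -/
def Bcard (n : ℕ) (γ : Measure (ℝ × ℝ)) (ε : ℝ) : ℕ := (Bset n γ ε).ncard

/-- The exponential of an extended real, with `exp(−∞) = 0`. -/
def expEReal (x : EReal) : ℝ := if x = ⊥ then 0 else Real.exp x.toReal

theorem Measure.le_volume_of_Ioo_le (ν : Measure ℝ)
    (h : ∀ a b : ℝ, ν (Set.Ioo a b) ≤ ENNReal.ofReal (b - a)) : ν ≤ volume := by
  have hIoc : ∀ a b : ℝ, ν (Set.Ioc a b) ≤ ENNReal.ofReal (b - a) := by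
    intro a b
    have hlim : Tendsto (fun c => ENNReal.ofReal (c - a)) (𝓝[>] b)
        (𝓝 (ENNReal.ofReal (b - a))) := by
      refine Tendsto.mono_left ?_ nhdsWithin_le_nhds
      exact (ENNReal.continuous_ofReal.comp (continuous_id.sub continuous_const)).tendsto b
    refine ge_of_tendsto hlim ?_
    filter_upwards [self_mem_nhdsWithin] with c hc
    exact (measure_mono (Set.Ioc_subset_Ioo_right hc)).trans (h a c)
  rw [Real.volume_eq_stieltjes_id, Measure.le_iff']
  intro s
  rw [StieltjesFunction.measure_def]
  change ν.toOuterMeasure s ≤ StieltjesFunction.id.outer s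
  refine (OuterMeasure.le_ofFunction.2 fun t => ?_) s
  rw [StieltjesFunction.length_eq]
  refine le_iInf fun a => le_iInf fun b => le_iInf fun ht => ?_
  have hbot : (botSet : Set ℝ) = ∅ := by
    ext x
    simp [botSet]
  rw [hbot, Set.sdiff_empty] at ht
  exact (measure_mono ht).trans (hIoc a b)

theorem measure_le_of_mem_queenons {γ : ProbabilityMeasure (ℝ × ℝ)} (hγ : γ ∈ queenons)
    {U : Set (ℝ × ℝ)} (hU : IsOpen U) {c : ℝ≥0∞}
    (h : ∀ μ : Measure (ℝ × ℝ), IsPermuton μ → SubUniformDiag μ → μ U ≤ c) :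
    γ.toMeasure U ≤ c := by
  rw [queenons, mem_closure_iff_clusterPt] at hγ
  obtain ⟨u, hu, huγ⟩ := clusterPt_iff_ultrafilter.1 hγ
  have h1 := ProbabilityMeasure.le_liminf_measure_open_of_tendsto
    (μs := id) (L := (u : Filter (ProbabilityMeasure (ℝ × ℝ)))) (μ := γ) huγ hU
  refine h1.trans ?_
  refine liminf_le_of_frequently_le' ?_
  have : ∀ᶠ μ in (u : Filter (ProbabilityMeasure (ℝ × ℝ))), μ.toMeasure U ≤ c := by
    filter_upwards [le_principal_iff.1 hu] with μ hμ
    obtain ⟨⟨N, _, hN⟩, hd⟩ := hμ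
    exact h _ hN.1 hd
  exact this.frequently

theorem measure_compl_unitSq_of_mem_queenons {γ : ProbabilityMeasure (ℝ × ℝ)}
    (hγ : γ ∈ queenons) : γ.toMeasure unitSqᶜ = 0 := by
  refine le_antisymm (measure_le_of_mem_queenons hγ ?_ fun μ hμ _ => hμ.2.1.le) zero_le
  exact (isClosed_Icc.prod isClosed_Icc).isOpen_compl

/-- A pushforward of a queenon is dominated by Lebesgue measure on `[l, u]` as soon as this
can be tested on closed subintervals. -/
theorem map_le_of_mem_queenons {γ : ProbabilityMeasure (ℝ × ℝ)} (hγ : γ ∈ queenons)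
    {f : ℝ × ℝ → ℝ} (hf : Continuous f) {l u : ℝ}
    (hlu : ∀ p ∈ unitSq, f p ∈ Set.Icc l u)
    (h : ∀ μ : Measure (ℝ × ℝ), IsPermuton μ → SubUniformDiag μ →
      ∀ a b : ℝ, l ≤ a → a ≤ b → b ≤ u →
        μ {p ∈ unitSq | a ≤ f p ∧ f p ≤ b} ≤ ENNReal.ofReal (b - a)) :
    γ.toMeasure.map f ≤ volume.restrict (Set.Icc l u) := by
  have h1 : γ.toMeasure.map f ≤ volume := by
    refine Measure.le_volume_of_Ioo_le _ fun a b => ?_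
    rw [Measure.map_apply hf.measurable measurableSet_Ioo]
    refine measure_le_of_mem_queenons hγ (isOpen_Ioo.preimage hf) fun μ hμ hd => ?_
    have hsub : f ⁻¹' Set.Ioo a b ⊆
        unitSqᶜ ∪ {p ∈ unitSq | max a l ≤ f p ∧ f p ≤ min b u} := by
      intro p hp
      by_cases hpu : p ∈ unitSq
      · have := hlu p hpu
        exact Or.inr ⟨hpu, max_le hp.1.le this.1, le_min hp.2.le this.2⟩
      · exact Or.inl hpu
    refine (measure_mono hsub).trans ((measure_union_le _ _).trans ?_)
    rw [hμ.2.1, zero_add]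
    by_cases hle : max a l ≤ min b u
    · refine (h μ hμ hd _ _ (le_max_right _ _) hle (min_le_right _ _)).trans ?_
      refine ENNReal.ofReal_le_ofReal ?_
      have := le_max_left a l
      have := min_le_left b u
      linarith
    · have : {p ∈ unitSq | max a l ≤ f p ∧ f p ≤ min b u} = ∅ := by
        ext p
        simp only [Set.mem_ofPred_eq, Set.mem_empty_iff_false, iff_false]
        exact fun hp => hle (hp.2.1.trans hp.2.2)
      rw [this, measure_empty]
      exact zero_le
  refine Measure.le_iff.2 fun s hs => ?_
  rw [Measure.restrict_apply hs]
  refine le_trans ?_ (h1 (s ∩ Set.Icc l u))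
  rw [Measure.map_apply hf.measurable hs,
    Measure.map_apply hf.measurable (hs.inter measurableSet_Icc)]
  have hsub : f ⁻¹' s ⊆ f ⁻¹' (s ∩ Set.Icc l u) ∪ unitSqᶜ := by
    intro p hp
    by_cases hpu : p ∈ unitSq
    · exact Or.inl ⟨hp, hlu p hpu⟩
    · exact Or.inr hpu
  refine (measure_mono hsub).trans ((measure_union_le _ _).trans ?_)
  rw [measure_compl_unitSq_of_mem_queenons hγ, add_zero]

theorem diagPlus_le_of_mem_queenons {γ : ProbabilityMeasure (ℝ × ℝ)} (hγ : γ ∈ queenons) :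
    diagPlus γ.toMeasure ≤ volume.restrict (Set.Icc (-1 : ℝ) 1) := by
  refine map_le_of_mem_queenons hγ (by fun_prop) ?_ fun μ _ hd a b ha hab hb =>
    (hd a b ha hab hb).1
  rintro p ⟨h1, h2⟩
  simp only [Set.mem_Icc] at *
  constructor <;> linarith [h1.1, h1.2, h2.1, h2.2]

theorem diagMinus_le_of_mem_queenons {γ : ProbabilityMeasure (ℝ × ℝ)} (hγ : γ ∈ queenons) :
    diagMinus γ.toMeasure ≤ volume.restrict (Set.Icc (-1 : ℝ) 1) := by
  refine map_le_of_mem_queenons hγ (by fun_prop) ?_ fun μ _ hd a b ha hab hb =>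
    (hd a b ha hab hb).2
  rintro p ⟨h1, h2⟩
  simp only [Set.mem_Icc] at *
  constructor <;> linarith [h1.1, h1.2, h2.1, h2.2]

theorem Measure.eq_of_le_of_univ_eq {X : Type*} [MeasurableSpace X] {μ ν : Measure X}
    [IsFiniteMeasure ν] (h : μ ≤ ν) (h' : μ Set.univ = ν Set.univ) : μ = ν := by
  have : IsFiniteMeasure μ := isFiniteMeasure_of_le ν h
  have h0 : ν - μ = 0 := by
    rw [← Measure.measure_univ_eq_zero, Measure.sub_apply .univ h, h', tsub_self]
  have := Measure.sub_add_cancel_of_le h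
  rwa [h0, zero_add] at this

theorem map_fst_of_mem_queenons {γ : ProbabilityMeasure (ℝ × ℝ)} (hγ : γ ∈ queenons) :
    γ.toMeasure.map Prod.fst = volume.restrict (Set.Icc (-(1 : ℝ) / 2) (1 / 2)) := by
  refine Measure.eq_of_le_of_univ_eq (map_le_of_mem_queenons hγ continuous_fst
    (fun p hp => hp.1) fun μ hμ _ a b ha hab hb => ?_) ?_
  · rw [← (hμ.2.2 a b ha hab hb).1]
    exact measure_mono fun p hp => ⟨hp.2, hp.1.2⟩
  · rw [Measure.map_apply measurable_fst .univ, Set.preimage_univ, measure_univ]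
    norm_num

theorem map_snd_of_mem_queenons {γ : ProbabilityMeasure (ℝ × ℝ)} (hγ : γ ∈ queenons) :
    γ.toMeasure.map Prod.snd = volume.restrict (Set.Icc (-(1 : ℝ) / 2) (1 / 2)) := by
  refine Measure.eq_of_le_of_univ_eq (map_le_of_mem_queenons hγ continuous_snd
    (fun p hp => hp.2) fun μ hμ _ a b ha hab hb => ?_) ?_
  · rw [← (hμ.2.2 a b ha hab hb).2]
    exact measure_mono fun p hp => ⟨hp.1.1, hp.2⟩
  · rw [Measure.map_apply measurable_snd .univ, Set.preimage_univ, measure_univ]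
    norm_num

/-- Gibbs' variational lower bound for the relative entropy. -/
theorem integral_log_add_le_DKL {X : Type*} [MeasurableSpace X] {μ ν : Measure X}
    [IsFiniteMeasure μ] [IsFiniteMeasure ν] {w : X → ℝ} (hw : ∀ᵐ x ∂ν, 0 < w x)
    (hwν : Integrable w ν) (hwμ : Integrable (fun x => Real.log (w x)) μ) :
    ((∫ x, Real.log (w x) ∂μ + μ.real Set.univ - ∫ x, w x ∂ν : ℝ) : EReal) ≤ DKL μ ν := by
  unfold DKL
  split_ifs with h
  · obtain ⟨hac, hint⟩ := h
    rw [EReal.coe_le_coe_iff]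
    set f := fun x => (μ.rnDeriv ν x).toReal with hf
    have e1 : ∫ x, f x * Real.log (f x) ∂ν = ∫ x, Real.log (f x) ∂μ :=
      integral_toReal_rnDeriv_mul hac
    have e2 : ∫ x, f x * Real.log (w x) ∂ν = ∫ x, Real.log (w x) ∂μ :=
      integral_toReal_rnDeriv_mul hac
    have e3 : ∫ x, f x ∂ν = μ.real Set.univ := Measure.integral_toReal_rnDeriv hac
    have i1 : Integrable (fun x => f x * Real.log (f x)) ν :=
      (integrable_rnDeriv_smul_iff hac).2 hint
    have i2 : Integrable (fun x => f x * Real.log (w x)) ν :=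
      (integrable_rnDeriv_smul_iff hac).2 hwμ
    have i3 : Integrable f ν := Measure.integrable_toReal_rnDeriv
    change _ ≤ ∫ x, Real.log (f x) ∂μ
    rw [← e1, ← e2, ← e3, ← integral_add i2 i3,
      ← integral_sub (f := fun x => f x * Real.log (w x) + f x) (i2.add i3) hwν]
    refine integral_mono_ae ((i2.add i3).sub hwν) i1 ?_
    filter_upwards [hw] with x hx
    have hfx : 0 ≤ f x := ENNReal.toReal_nonneg
    rcases hfx.eq_or_lt with h0 | hpos
    · simp [← h0, hx.le]
    · have h2 := Real.log_le_sub_one_of_pos (div_pos hx hpos)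
      rw [Real.log_div hx.ne' hpos.ne'] at h2
      have h3 := mul_le_mul_of_nonneg_left h2 hpos.le
      have h4 : f x * (w x / f x - 1) = w x - f x := by field_simp
      nlinarith
  · exact le_top

theorem log_lower_barMeasure {ρ : Measure ℝ} [IsProbabilityMeasure ρ]
    (hρ : ρ ≤ volume.restrict (Set.Icc (-1 : ℝ) 1)) {F : ℝ → ℝ} (hF : Continuous F)
    (hFpos : ∀ s ∈ Set.Icc (-1 : ℝ) 1, 0 < F s) :
    Integrable (fun s => Real.log (F s)) ρ ∧
    ((Real.log 2 + (∫ s in Set.Icc (-1 : ℝ) 1, Real.log (F s)) - ∫ s, Real.log (F s) ∂ρ + 1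
        - ∫ s in Set.Icc (-1 : ℝ) 1, F s : ℝ) : EReal)
      ≤ DKL (volume.restrict (Set.Icc (-1 : ℝ) 1) - ρ) unif11 := by
  set lam : Measure ℝ := volume.restrict (Set.Icc (-1 : ℝ) 1) with hlam
  set β : Measure ℝ := lam - ρ with hβ
  have hadd : β + ρ = lam := Measure.sub_add_cancel_of_le hρ
  have hβle : β ≤ lam := Measure.sub_le
  have hβfin : IsFiniteMeasure β := isFiniteMeasure_of_le lam hβle
  have hlog : Integrable (fun s => Real.log (F s)) lam := by
    refine ContinuousOn.integrableOn_compact isCompact_Icc ?_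
    exact hF.continuousOn.log fun s hs => (hFpos s hs).ne'
  have hmem : ∀ᵐ s ∂lam, s ∈ Set.Icc (-1 : ℝ) 1 := ae_restrict_mem measurableSet_Icc
  have hmass : β.real Set.univ = 1 := by
    have h1 : β Set.univ + ρ Set.univ = lam Set.univ := by
      rw [← hadd, Measure.add_apply]
    have h2 : β.real Set.univ + ρ.real Set.univ = lam.real Set.univ := by
      rw [measureReal_def, measureReal_def, measureReal_def, ← h1,
        ENNReal.toReal_add (measure_ne_top _ _) (measure_ne_top _ _)]
    have h3 : lam.real Set.univ = 2 := by
      simp [hlam, measureReal_def]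
      norm_num
    rw [probReal_univ (μ := ρ), h3] at h2
    linarith
  have hunif : IsFiniteMeasure unif11 := by
    unfold unif11
    exact Measure.smul_finite _ (by simp)
  have hlogβ := hlog.mono_measure hβle
  have hlogρ := hlog.mono_measure hρ
  refine ⟨hlogρ, ?_⟩
  have haeβ : ∀ᵐ s ∂β, Real.log (2 * F s) = Real.log 2 + Real.log (F s) := by
    filter_upwards [(Measure.absolutelyContinuous_of_le hβle).ae_le hmem] with s hs
    exact Real.log_mul two_ne_zero (hFpos s hs).ne'
  have hg := integral_log_add_le_DKL (μ := β) (ν := unif11) (w := fun s => 2 * F s) ?_ ?_ ?_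
  · refine le_trans (le_of_eq ?_) hg
    congr 1
    have hsum : ∫ s, Real.log (F s) ∂lam
        = ∫ s, Real.log (F s) ∂β + ∫ s, Real.log (F s) ∂ρ := by
      rw [← hadd, integral_add_measure hlogβ hlogρ]
    have h1 : ∫ s, Real.log (2 * F s) ∂β = Real.log 2 + ∫ s, Real.log (F s) ∂β := by
      rw [integral_congr_ae haeβ, integral_add (integrable_const _) hlogβ, integral_const, hmass,
        one_smul]
    have h2 : ∫ s, 2 * F s ∂unif11 = ∫ s, F s ∂lam := by
      rw [unif11, integral_smul_measure, integral_const_mul]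
      simp
      rfl
    rw [h1, h2, hmass, hsum]
    ring
  · unfold unif11
    refine Measure.ae_smul_measure ?_ _
    filter_upwards [hmem] with s hs
    have := hFpos s hs
    positivity
  · unfold unif11
    refine Integrable.smul_measure ?_ (by simp)
    exact (hF.continuousOn.integrableOn_compact isCompact_Icc).const_mul 2
  · exact (Integrable.add (integrable_const (Real.log 2)) hlogβ).congr
      (haeβ.mono fun s hs => hs.symm)

/-- Weak duality: every pair of positive weights gives an upper bound for the Q-entropy. -/
theorem Hq_le_dual {γ : ProbabilityMeasure (ℝ × ℝ)} (hγ : γ ∈ queenons)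
    {F P : ℝ → ℝ} (hF : Continuous F) (hP : Continuous P)
    (hFpos : ∀ s ∈ Set.Icc (-1 : ℝ) 1, 0 < F s)
    (hPpos : ∀ x ∈ Set.Icc (-(1 : ℝ) / 2) (1 / 2), 0 < P x) :
    Hq γ.toMeasure ≤ (((∫ p in unitSq, F (p.1 + p.2) * F (p.2 - p.1) * (P p.1 * P p.2))
      - 2 * (∫ x in Set.Icc (-(1 : ℝ) / 2) (1 / 2), Real.log (P x))
      - 2 * (∫ s in Set.Icc (-1 : ℝ) 1, Real.log (F s))
      + 2 * (∫ s in Set.Icc (-1 : ℝ) 1, F s) - 6 : ℝ) : EReal) := by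
  set μ := γ.toMeasure with hμ
  have hmp : Measurable fun p : ℝ × ℝ => p.1 + p.2 := by fun_prop
  have hmm : Measurable fun p : ℝ × ℝ => p.2 - p.1 := by fun_prop
  have : IsProbabilityMeasure (diagPlus μ) := Measure.isProbabilityMeasure_map hmp.aemeasurable
  have : IsProbabilityMeasure (diagMinus μ) := Measure.isProbabilityMeasure_map hmm.aemeasurable
  obtain ⟨ip, hp⟩ := log_lower_barMeasure (diagPlus_le_of_mem_queenons hγ) hF hFpos
  obtain ⟨im, hm⟩ := log_lower_barMeasure (diagMinus_le_of_mem_queenons hγ) hF hFpos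
  have hlF : Measurable fun s => Real.log (F s) := Real.measurable_log.comp hF.measurable
  have hlP : Measurable fun s => Real.log (P s) := Real.measurable_log.comp hP.measurable
  have iP : Integrable (fun x => Real.log (P x))
      (volume.restrict (Set.Icc (-(1 : ℝ) / 2) (1 / 2))) := by
    refine ContinuousOn.integrableOn_compact isCompact_Icc ?_
    exact hP.continuousOn.log fun s hs => (hPpos s hs).ne'
  have ip' : Integrable (fun p : ℝ × ℝ => Real.log (F (p.1 + p.2))) μ :=
    (integrable_map_measure hlF.aestronglyMeasurable hmp.aemeasurable).1 ip
  have im' : Integrable (fun p : ℝ × ℝ => Real.log (F (p.2 - p.1))) μ :=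
    (integrable_map_measure hlF.aestronglyMeasurable hmm.aemeasurable).1 im
  have i1 : Integrable (fun p : ℝ × ℝ => Real.log (P p.1)) μ := by
    rw [← map_fst_of_mem_queenons hγ] at iP
    exact (integrable_map_measure hlP.aestronglyMeasurable measurable_fst.aemeasurable).1 iP
  have i2 : Integrable (fun p : ℝ × ℝ => Real.log (P p.2)) μ := by
    rw [← map_snd_of_mem_queenons hγ] at iP
    exact (integrable_map_measure hlP.aestronglyMeasurable measurable_snd.aemeasurable).1 iP
  have ep : ∫ p, Real.log (F (p.1 + p.2)) ∂μ = ∫ s, Real.log (F s) ∂(diagPlus μ) :=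
    (integral_map hmp.aemeasurable hlF.aestronglyMeasurable).symm
  have em : ∫ p, Real.log (F (p.2 - p.1)) ∂μ = ∫ s, Real.log (F s) ∂(diagMinus μ) :=
    (integral_map hmm.aemeasurable hlF.aestronglyMeasurable).symm
  have e1 : ∫ p, Real.log (P p.1) ∂μ
      = ∫ x in Set.Icc (-(1 : ℝ) / 2) (1 / 2), Real.log (P x) := by
    rw [← map_fst_of_mem_queenons hγ, integral_map measurable_fst.aemeasurable
      hlP.aestronglyMeasurable]
  have e2 : ∫ p, Real.log (P p.2) ∂μ
      = ∫ x in Set.Icc (-(1 : ℝ) / 2) (1 / 2), Real.log (P x) := by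
    rw [← map_snd_of_mem_queenons hγ, integral_map measurable_snd.aemeasurable
      hlP.aestronglyMeasurable]
  have hcpt : IsCompact unitSq := isCompact_Icc.prod isCompact_Icc
  have hmeas : MeasurableSet unitSq := hcpt.measurableSet
  have hin : ∀ p ∈ unitSq, (0 < F (p.1 + p.2) ∧ 0 < F (p.2 - p.1)) ∧ 0 < P p.1 ∧ 0 < P p.2 := by
    rintro p ⟨h1, h2⟩
    have h1' := h1
    have h2' := h2
    simp only [Set.mem_Icc] at h1' h2'
    exact ⟨⟨hFpos _ ⟨by linarith [h1'.1, h2'.1], by linarith [h1'.2, h2'.2]⟩,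
      hFpos _ ⟨by linarith [h1'.2, h2'.1], by linarith [h1'.1, h2'.2]⟩⟩, hPpos _ h1, hPpos _ h2⟩
  have hae : ∀ᵐ p ∂μ, Real.log (F (p.1 + p.2) * F (p.2 - p.1) * (P p.1 * P p.2))
      = Real.log (F (p.1 + p.2)) + Real.log (F (p.2 - p.1))
        + (Real.log (P p.1) + Real.log (P p.2)) := by
    have : ∀ᵐ p ∂μ, p ∈ unitSq := measure_compl_unitSq_of_mem_queenons hγ
    filter_upwards [this] with p hpu
    obtain ⟨⟨h1, h2⟩, h3, h4⟩ := hin p hpu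
    rw [Real.log_mul (by positivity) (by positivity), Real.log_mul h1.ne' h2.ne',
      Real.log_mul h3.ne' h4.ne']
  have hfin : IsFiniteMeasure ((volume : Measure (ℝ × ℝ)).restrict unitSq) :=
    ⟨by rw [Measure.restrict_apply_univ]; exact hcpt.measure_lt_top⟩
  have hd := integral_log_add_le_DKL (μ := μ) (ν := volume.restrict unitSq)
    (w := fun p => F (p.1 + p.2) * F (p.2 - p.1) * (P p.1 * P p.2))
    (by
      filter_upwards [ae_restrict_mem hmeas] with p hpu
      obtain ⟨⟨h1, h2⟩, h3, h4⟩ := hin p hpu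
      positivity)
    (ContinuousOn.integrableOn_compact hcpt (by fun_prop))
    (((ip'.add im').add (i1.add i2)).congr (hae.mono fun p hp => hp.symm))
  rw [integral_congr_ae hae, integral_add
      (f := fun p : ℝ × ℝ => Real.log (F (p.1 + p.2)) + Real.log (F (p.2 - p.1)))
      (g := fun p : ℝ × ℝ => Real.log (P p.1) + Real.log (P p.2))
      (ip'.add im') (i1.add i2), integral_add ip' im',
    integral_add i1 i2, ep, em, e1, e2, probReal_univ] at hd
  have hneg : Hq μ ≤ _ := add_le_add_left
    (EReal.sub_le_sub (EReal.sub_le_sub (EReal.neg_le_neg_iff.2 hd) hp) hm) _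
  refine hneg.trans (le_of_eq ?_)
  norm_cast
  ring

theorem arctan_le_taylor {x : ℝ} (hx : 0 ≤ x) :
    Real.arctan x ≤ x - x ^ 3 / 3 + x ^ 5 / 5 - x ^ 7 / 7 + x ^ 9 / 9 := by
  let f : ℝ → ℝ := fun t =>
    t - t ^ 3 / 3 + t ^ 5 / 5 - t ^ 7 / 7 + t ^ 9 / 9 - Real.arctan t
  have hd : ∀ t, HasDerivAt f (t ^ 10 / (1 + t ^ 2)) t := by
    intro t
    have h := (((((hasDerivAt_id t).sub ((hasDerivAt_pow 3 t).div_const 3)).add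
      ((hasDerivAt_pow 5 t).div_const 5)).sub ((hasDerivAt_pow 7 t).div_const 7)).add
      ((hasDerivAt_pow 9 t).div_const 9)).sub (Real.hasDerivAt_arctan t)
    refine h.congr_deriv ?_
    have : 1 + t ^ 2 ≠ 0 := by positivity
    norm_num
    field_simp
    ring
  have hmono : Monotone f := monotone_of_hasDerivAt_nonneg hd fun t => by positivity
  have h := hmono hx
  simp only [f] at h
  norm_num at h
  linarith

theorem setIntegral_Icc_eq_sub {f G : ℝ → ℝ} {a b : ℝ} (hab : a ≤ b)
    (hd : ∀ x ∈ Set.Icc a b, HasDerivAt G (f x) x) (hf : ContinuousOn f (Set.Icc a b)) :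
    ∫ x in Set.Icc a b, f x = G b - G a := by
  rw [integral_Icc_eq_integral_Ioc, ← intervalIntegral.integral_of_le hab]
  rw [← Set.uIcc_of_le hab] at hd hf
  exact intervalIntegral.integral_eq_sub_of_hasDerivAt hd hf.intervalIntegrable

/-- The dual weight attached to the diagonals. -/
def dualDiag (s : ℝ) : ℝ := 72 / 3625 * (9 + 49 * s ^ 2)

/-- The dual weight attached to the rows and columns. -/
def dualRow (x : ℝ) : ℝ := 128 / 27 * (1 - x ^ 2) ^ 4

theorem dualDiag_pos (s : ℝ) : 0 < dualDiag s := by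
  unfold dualDiag
  positivity

theorem continuous_dualDiag : Continuous dualDiag := by
  unfold dualDiag
  fun_prop

theorem continuous_dualRow : Continuous dualRow := by
  unfold dualRow
  fun_prop

theorem one_sub_sq_pos {x : ℝ} (hx : x ∈ Set.Icc (-(1 : ℝ) / 2) (1 / 2)) :
    0 < 1 + x ∧ 0 < 1 - x := by
  obtain ⟨h1, h2⟩ := hx
  constructor <;> linarith

theorem dualRow_pos {x : ℝ} (hx : x ∈ Set.Icc (-(1 : ℝ) / 2) (1 / 2)) : 0 < dualRow x := by
  obtain ⟨h1, h2⟩ := one_sub_sq_pos hx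
  have : 0 < 1 - x ^ 2 := by nlinarith
  unfold dualRow
  positivity

theorem integral_dualDiag : ∫ s in Set.Icc (-1 : ℝ) 1, dualDiag s = 3648 / 3625 := by
  rw [setIntegral_Icc_eq_sub (G := fun s => 72 / 3625 * (9 * s + 49 * (s ^ 3 / 3))) (by norm_num)
    ?_ continuous_dualDiag.continuousOn]
  · norm_num
  · intro x _
    refine ((((hasDerivAt_id x).const_mul 9).add
      (((hasDerivAt_pow 3 x).div_const 3).const_mul 49)).const_mul (72 / 3625)).congr_deriv ?_
    unfold dualDiag
    norm_num

theorem integral_log_dualDiag :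
    ∫ s in Set.Icc (-1 : ℝ) 1, Real.log (dualDiag s)
      = 2 * Real.log (144 / 125) - 4 + 12 / 7 * Real.arctan (7 / 3) := by
  rw [setIntegral_Icc_eq_sub
    (G := fun s => s * Real.log (dualDiag s) - 2 * s + 6 / 7 * Real.arctan (7 / 3 * s))
    (by norm_num) ?_
    (continuous_dualDiag.continuousOn.log fun s _ => (dualDiag_pos s).ne')]
  · have h1 : dualDiag 1 = 144 / 125 := by norm_num [dualDiag]
    have h2 : dualDiag (-1) = 144 / 125 := by norm_num [dualDiag]
    simp only [h1, h2, mul_one, mul_neg, Real.arctan_neg]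
    ring
  · intro x _
    have hF : HasDerivAt dualDiag (72 / 3625 * (98 * x)) x := by
      unfold dualDiag
      refine ((((hasDerivAt_pow 2 x).const_mul 49).const_add 9).const_mul (72 / 3625)).congr_deriv
        ?_
      norm_num
      ring
    have hA : HasDerivAt (fun s : ℝ => Real.arctan (7 / 3 * s))
        (1 / (1 + (7 / 3 * x) ^ 2) * (7 / 3 * 1)) x :=
      ((hasDerivAt_id x).const_mul (7 / 3 : ℝ)).arctan
    refine ((((hasDerivAt_id x).mul (hF.log (dualDiag_pos x).ne')).sub
      ((hasDerivAt_id x).const_mul 2)).add (hA.const_mul (6 / 7))).congr_deriv ?_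
    have h1 : 9 + 49 * x ^ 2 ≠ 0 := by positivity
    have h2 : (1 + (7 / 3 * x) ^ 2) ≠ 0 := by positivity
    simp only [id]
    unfold dualDiag
    field_simp
    ring

theorem integral_log_dualRow :
    ∫ x in Set.Icc (-(1 : ℝ) / 2) (1 / 2), Real.log (dualRow x)
      = Real.log (128 / 27) + 4 * (3 * Real.log (3 / 2) + Real.log 2 - 2) := by
  have hlog : ∀ x ∈ Set.Icc (-(1 : ℝ) / 2) (1 / 2), Real.log (dualRow x)
      = Real.log (128 / 27) + 4 * (Real.log (1 + x) + Real.log (1 - x)) := by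
    intro x hx
    obtain ⟨h1, h2⟩ := one_sub_sq_pos hx
    rw [dualRow, show 1 - x ^ 2 = (1 + x) * (1 - x) by ring,
      Real.log_mul (by norm_num) (by positivity), Real.log_pow, Real.log_mul h1.ne' h2.ne']
    norm_num
  rw [setIntegral_Icc_eq_sub
    (G := fun x => Real.log (128 / 27) * x
      + 4 * ((1 + x) * Real.log (1 + x) - (1 - x) * Real.log (1 - x) - 2 * x))
    (by norm_num) ?_
    (continuous_dualRow.continuousOn.log fun s hs => (dualRow_pos hs).ne')]
  · have h : Real.log (1 / 2) = -Real.log 2 := by rw [one_div, Real.log_inv]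
    norm_num [h]
    ring
  · intro x hx
    obtain ⟨h1, h2⟩ := one_sub_sq_pos hx
    rw [hlog x hx]
    have hp : HasDerivAt (fun t : ℝ => 1 + t) 1 x := (hasDerivAt_id x).const_add 1
    have hm : HasDerivAt (fun t : ℝ => 1 - t) (-1) x := (hasDerivAt_id x).const_sub 1
    refine (((hasDerivAt_id x).const_mul (Real.log (128 / 27))).add
      ((((hp.mul (hp.log h1.ne')).sub (hm.mul (hm.log h2.ne'))).sub
        ((hasDerivAt_id x).const_mul 2)).const_mul 4)).congr_deriv ?_
    field_simp
    ring

/-- The even moments of `(1 - x²)⁴` on `[-1/2, 1/2]`. -/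
def rowMoment (k : ℕ) : ℝ :=
  ∫ x in Set.Icc (-(1 : ℝ) / 2) (1 / 2), x ^ (2 * k) * (1 - x ^ 2) ^ 4

theorem rowMoment_eq (k : ℕ) :
    rowMoment k = (1 / 2) ^ (2 * k) * (1 / (2 * k + 1) - 1 / (2 * k + 3) + 3 / 8 / (2 * k + 5)
      - 1 / 16 / (2 * k + 7) + 1 / 256 / (2 * k + 9)) := by
  unfold rowMoment
  rw [setIntegral_Icc_eq_sub
    (G := fun x => x ^ (2 * k + 1) / (2 * k + 1) - 4 * (x ^ (2 * k + 3) / (2 * k + 3))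
      + 6 * (x ^ (2 * k + 5) / (2 * k + 5)) - 4 * (x ^ (2 * k + 7) / (2 * k + 7))
      + x ^ (2 * k + 9) / (2 * k + 9)) (by norm_num) ?_ (by fun_prop)]
  · have h : (-1 / 2 : ℝ) ^ (2 * k) = (1 / 2) ^ (2 * k) := by
      rw [pow_mul, pow_mul]
      norm_num
    simp only [pow_add, h]
    field_simp
    ring
  · intro x _
    refine ((((((hasDerivAt_pow (2 * k + 1) x).div_const _).sub
      (((hasDerivAt_pow (2 * k + 3) x).div_const _).const_mul 4)).add
      (((hasDerivAt_pow (2 * k + 5) x).div_const _).const_mul 6)).sub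
      (((hasDerivAt_pow (2 * k + 7) x).div_const _).const_mul 4)).add
      ((hasDerivAt_pow (2 * k + 9) x).div_const _)).congr_deriv ?_
    push_cast
    simp only [pow_add]
    field_simp
    ring

theorem setIntegral_unitSq_moments (k l : ℕ) :
    ∫ p in unitSq, (p.1 ^ (2 * k) * (1 - p.1 ^ 2) ^ 4) * (p.2 ^ (2 * l) * (1 - p.2 ^ 2) ^ 4)
      = rowMoment k * rowMoment l :=
  setIntegral_prod_mul (μ := volume) (ν := volume)
    (fun x : ℝ => x ^ (2 * k) * (1 - x ^ 2) ^ 4) (fun x : ℝ => x ^ (2 * l) * (1 - x ^ 2) ^ 4) _ _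

theorem integral_dualWeight :
    ∫ p in unitSq, dualDiag (p.1 + p.2) * dualDiag (p.2 - p.1) * (dualRow p.1 * dualRow p.2)
      = 3687063156454952 / 3691801629140625 := by
  let q : ℕ → ℕ → ℝ × ℝ → ℝ := fun k l p =>
    (p.1 ^ (2 * k) * (1 - p.1 ^ 2) ^ 4) * (p.2 ^ (2 * l) * (1 - p.2 ^ 2) ^ 4)
  have hq : ∀ k l, ∫ p in unitSq, q k l p = rowMoment k * rowMoment l :=
    setIntegral_unitSq_moments
  have hi : ∀ (c : ℝ) k l, IntegrableOn (fun p => c * q k l p) unitSq := fun c k l =>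
    ContinuousOn.integrableOn_compact (isCompact_Icc.prod isCompact_Icc)
      (Continuous.continuousOn (by fun_prop))
  have hsum : ∀ p : ℝ × ℝ,
      dualDiag (p.1 + p.2) * dualDiag (p.2 - p.1) * (dualRow p.1 * dualRow p.2)
      = (72 / 3625) ^ 2 * (128 / 27) ^ 2 * (81 * q 0 0 p + (882 * q 1 0 p + (882 * q 0 1 p
        + (2401 * q 2 0 p + ((-4802) * q 1 1 p + 2401 * q 0 2 p))))) := by
    intro p
    simp only [q, dualDiag, dualRow]
    ring
  have h4 := (hi (-4802) 1 1).add (hi 2401 0 2)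
  have h3 := (hi 2401 2 0).add h4
  have h2 := (hi 882 0 1).add h3
  have h1 := (hi 882 1 0).add h2
  have h := integral_add' (hi 81 0 0) h1
  rw [integral_add' (hi 882 1 0) h2, integral_add' (hi 882 0 1) h3, integral_add' (hi 2401 2 0) h4,
    integral_add' (hi (-4802) 1 1) (hi 2401 0 2)] at h
  simp only [hsum]
  rw [integral_const_mul]
  refine (congrArg _ h).trans ?_
  simp only [integral_const_mul, hq, rowMoment_eq]
  norm_num

theorem dual_value_le :
    (3687063156454952 / 3691801629140625 : ℝ)
      - 2 * (Real.log (128 / 27) + 4 * (3 * Real.log (3 / 2) + Real.log 2 - 2))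
      - 2 * (2 * Real.log (144 / 125) - 4 + 12 / 7 * Real.arctan (7 / 3))
      + 2 * (3648 / 3625) - 6 ≤ -1.94 := by
  have e1 : Real.log (128 / 27) = 7 * Real.log 2 - 3 * Real.log 3 := by
    rw [show (128 / 27 : ℝ) = 2 ^ 7 / 3 ^ 3 by norm_num, Real.log_div (by norm_num) (by norm_num),
      Real.log_pow, Real.log_pow]
    norm_num
  have e2 : Real.log (3 / 2) = Real.log 3 - Real.log 2 :=
    Real.log_div (by norm_num) (by norm_num)
  have e3 : Real.log (144 / 125) = 4 * Real.log 2 + 2 * Real.log 3 - 3 * Real.log 5 := by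
    rw [show (144 / 125 : ℝ) = 2 ^ 4 * 3 ^ 2 / 5 ^ 3 by norm_num,
      Real.log_div (by norm_num) (by norm_num), Real.log_mul (by norm_num) (by norm_num),
      Real.log_pow, Real.log_pow, Real.log_pow]
    norm_num
  have e4 : Real.arctan (7 / 3) = Real.pi / 2 - Real.arctan (3 / 7) := by
    rw [← Real.arctan_inv_of_pos (by norm_num)]
    norm_num
  have h5 := arctan_le_taylor (x := 3 / 7) (by norm_num)
  rw [e1, e2, e3, e4]
  norm_num at h5 ⊢
  linarith [Real.log_two_gt_d9, Real.log_two_lt_d9, Real.log_three_gt_d9, Real.log_three_lt_d9,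
    Real.log_five_gt_d9, Real.log_five_lt_d9, Real.pi_gt_d6]

theorem Hq_le_of_mem_queenons {γ : ProbabilityMeasure (ℝ × ℝ)} (hγ : γ ∈ queenons) :
    Hq γ.toMeasure ≤ ((-1.94 : ℝ) : EReal) := by
  refine (Hq_le_dual hγ continuous_dualDiag continuous_dualRow (fun s _ => dualDiag_pos s)
    fun x hx => dualRow_pos hx).trans ?_
  rw [integral_dualWeight, integral_log_dualRow, integral_log_dualDiag, integral_dualDiag]
  exact_mod_cast dual_value_le

/-- The degree seven Taylor polynomial of `log (1 + u)` at `0`. -/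
def logTaylor {K : Type*} [DivisionRing K] (u : K) : K :=
  u * (1 - u * (1 / 2 - u * (1 / 3 - u * (1 / 4 - u * (1 / 5 - u * (1 / 6 - u * (1 / 7)))))))

theorem log_one_add_le_logTaylor {u : ℝ} (hu : -1 < u) : Real.log (1 + u) ≤ logTaylor u := by
  let f : ℝ → ℝ := fun t => logTaylor t - Real.log (1 + t)
  have hd : ∀ t ∈ Set.Ioi (-1 : ℝ), HasDerivAt f (t ^ 7 / (1 + t)) t := by
    intro t ht
    have h1 : 1 + t ≠ 0 := by
      have := Set.mem_Ioi.1 ht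
      linarith
    have hpoly : logTaylor = fun t : ℝ => t - t ^ 2 / 2 + t ^ 3 / 3 - t ^ 4 / 4 + t ^ 5 / 5
        - t ^ 6 / 6 + t ^ 7 / 7 := by
      funext s
      unfold logTaylor
      ring
    have hlog : HasDerivAt (fun s : ℝ => Real.log (1 + s)) (1 / (1 + t)) t :=
      ((hasDerivAt_id t).const_add 1).log h1
    simp only [f, hpoly]
    refine ((((((((hasDerivAt_id t).sub ((hasDerivAt_pow 2 t).div_const 2)).add
      ((hasDerivAt_pow 3 t).div_const 3)).sub ((hasDerivAt_pow 4 t).div_const 4)).add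
      ((hasDerivAt_pow 5 t).div_const 5)).sub ((hasDerivAt_pow 6 t).div_const 6)).add
      ((hasDerivAt_pow 7 t).div_const 7)).sub hlog).congr_deriv ?_
    norm_num
    field_simp
    ring
  have hf0 : f 0 = 0 := by simp [f, logTaylor]
  suffices 0 ≤ f u by
    simp only [f] at this
    linarith
  rw [← hf0]
  rcases le_total 0 u with h | h
  · have hmono : MonotoneOn f (Set.Ici 0) := by
      refine monotoneOn_of_hasDerivWithinAt_nonneg (f' := fun t => t ^ 7 / (1 + t))
        (convex_Ici 0) (fun t ht => (hd t ?_).continuousAt.continuousWithinAt)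
        (fun t ht => (hd t ?_).hasDerivWithinAt) fun t ht => ?_
      · exact lt_of_lt_of_le (by norm_num) (Set.mem_Ici.1 ht)
      · exact lt_of_lt_of_le (by norm_num) (Set.mem_Ici.1 (interior_subset ht))
      · have : (0 : ℝ) ≤ t := Set.mem_Ici.1 (interior_subset ht)
        positivity
    exact hmono (Set.mem_Ici.2 le_rfl) h h
  · have hanti : AntitoneOn f (Set.Ioc (-1) 0) := by
      refine antitoneOn_of_hasDerivWithinAt_nonpos (f' := fun t => t ^ 7 / (1 + t))
        (convex_Ioc (-1) 0) (fun t ht => (hd t ht.1).continuousAt.continuousWithinAt)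
        (fun t ht => (hd t (interior_subset ht).1).hasDerivWithinAt) fun t ht => ?_
      have h1 := (interior_subset ht).1
      have h2 := (interior_subset ht).2
      exact div_nonpos_of_nonpos_of_nonneg (Odd.pow_nonpos (by decide) h2) (by linarith)
    exact hanti ⟨hu, h⟩ ⟨by norm_num, le_rfl⟩ h

/-- A rational upper bound for the logarithm of a positive rational, obtained by rescaling the
argument by a power of two before applying `logTaylor`. -/
def logUpper (t : ℚ) : ℚ :=
  if 7 / 10 ≤ t then logTaylor (t - 1)
  else if 7 / 20 ≤ t then logTaylor (2 * t - 1) - 0.6931471803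
  else if 7 / 40 ≤ t then logTaylor (4 * t - 1) - 2 * 0.6931471803
  else logTaylor (8 * t - 1) - 3 * 0.6931471803

theorem log_le_logTaylor_rescaled {t : ℚ} (ht : 0 < t) (e : ℕ) :
    Real.log t ≤ ((logTaylor (2 ^ e * t - 1) - e * 0.6931471803 : ℚ) : ℝ) := by
  have ht' : (0 : ℝ) < t := by exact_mod_cast ht
  have h : Real.log t = Real.log (1 + (2 ^ e * (t : ℝ) - 1)) - e * Real.log 2 := by
    rw [add_sub_cancel, Real.log_mul (by positivity) ht'.ne', Real.log_pow]
    ring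
  have hpos : (0 : ℝ) < 2 ^ e * t := by positivity
  have h1 := log_one_add_le_logTaylor (u := 2 ^ e * (t : ℝ) - 1) (by linarith)
  have h2 : (e : ℝ) * 0.6931471803 ≤ e * Real.log 2 :=
    mul_le_mul_of_nonneg_left Real.log_two_gt_d9.le (by positivity)
  rw [h]
  unfold logTaylor at h1 ⊢
  push_cast
  linarith

theorem log_le_logUpper {t : ℚ} (ht : 0 < t) : Real.log t ≤ (logUpper t : ℝ) := by
  unfold logUpper
  split_ifs
  · simpa using log_le_logTaylor_rescaled ht 0
  · simpa using log_le_logTaylor_rescaled ht 1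
  · have := log_le_logTaylor_rescaled ht 2
    norm_num at this ⊢
    exact this
  · have := log_le_logTaylor_rescaled ht 3
    norm_num at this ⊢
    exact this

/-- The profile generating the densities of the explicit step permuton. -/
def profile (i : ℕ) : ℤ := 196 - i * (49 - i) / 2

/-- The rational densities of the explicit step permuton on the `50 × 50` grid. -/
def gridDensity (i j : ℕ) : ℚ := 1 - (profile i * profile j : ℤ) / 52000

/-- The values at the grid points of the density of the complementary diagonal measures. -/
def diagDeficit (k : ℕ) : ℚ :=
  1 - (∑ i ∈ Finset.range 50, if i ≤ k ∧ k - i < 50 then gridDensity i (k - i) else 0) / 50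

theorem gridDensity_pos : ∀ i < 50, ∀ j < 50, 0 < gridDensity i j := by
  decide +kernel

theorem diagDeficit_pos : ∀ k < 99, 0 < diagDeficit k := by
  decide +kernel

theorem sum_profile : ∑ i ∈ Finset.range 50, profile i = 0 := by
  decide +kernel

theorem profile_rev : ∀ i < 50, profile (49 - i) = profile i := by
  decide +kernel

theorem entropy_rat_le :
    (∑ i ∈ Finset.range 50, ∑ j ∈ Finset.range 50, gridDensity i j * logUpper (gridDensity i j))
        / 2500
      + 2 * ((∑ k ∈ Finset.range 99, diagDeficit k * logUpper (diagDeficit k)) / 50) + 3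
      ≤ 1.9449 := by
  decide +kernel

theorem DKL_withDensity_ofReal {X : Type*} [MeasurableSpace X] {ν : Measure X} [SigmaFinite ν]
    {f : X → ℝ} (hf : Measurable f) (h0 : ∀ᵐ x ∂ν, 0 ≤ f x)
    (hint : Integrable (fun x => f x * Real.log (f x)) ν) :
    DKL (ν.withDensity fun x => ENNReal.ofReal (f x)) ν
      = ((∫ x, f x * Real.log (f x) ∂ν : ℝ) : EReal) := by
  set μ := ν.withDensity fun x => ENNReal.ofReal (f x) with hμ
  have hm : Measurable fun x => ENNReal.ofReal (f x) := hf.ennreal_ofReal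
  have hac : μ ≪ ν := withDensity_absolutelyContinuous _ _
  have hlt : ∀ᵐ x ∂ν, ENNReal.ofReal (f x) < ∞ := ae_of_all _ fun x => ENNReal.ofReal_lt_top
  have hrn : (fun x => Real.log (μ.rnDeriv ν x).toReal) =ᵐ[μ] fun x => Real.log (f x) := by
    filter_upwards [hac.ae_le (Measure.rnDeriv_withDensity ν hm), hac.ae_le h0] with x hx hx0
    rw [hx, ENNReal.toReal_ofReal hx0]
  have hmul : (fun x => (ENNReal.ofReal (f x)).toReal • Real.log (f x))
      =ᵐ[ν] fun x => f x * Real.log (f x) := by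
    filter_upwards [h0] with x hx0
    rw [ENNReal.toReal_ofReal hx0, smul_eq_mul]
  have hi : Integrable (fun x => Real.log (μ.rnDeriv ν x).toReal) μ := by
    rw [integrable_congr hrn, hμ, integrable_withDensity_iff_integrable_smul' hm hlt,
      integrable_congr hmul]
    exact hint
  rw [DKL, if_pos ⟨hac, hi⟩, integral_congr_ae hrn, hμ,
    integral_withDensity_eq_integral_toReal_smul hm hlt,
    integral_congr_ae hmul]

theorem measurableSet_unitSq : MeasurableSet unitSq := measurableSet_Icc.prod measurableSet_Icc

/-- The `i`-th interval of the subdivision of `[-1/2, 1/2]` into `N` equal parts. -/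
def gridCell (N i : ℕ) : Set ℝ :=
  Set.Icc (-(1 : ℝ) / 2 + (i : ℝ) / N) (-(1 : ℝ) / 2 + ((i : ℝ) + 1) / N)

/-- Lebesgue measure on the `i`-th interval of the subdivision. -/
def cellMeasure (N i : ℕ) : Measure ℝ := volume.restrict (gridCell N i)

instance isFiniteMeasure_cellMeasure (N i : ℕ) : IsFiniteMeasure (cellMeasure N i) := by
  unfold cellMeasure gridCell
  infer_instance

theorem gridSq_succ (N i j : ℕ) :
    gridSq N (i + 1) (j + 1) = gridCell N i ×ˢ gridCell N j := by
  simp [gridSq, gridCell]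

theorem cellMeasure_prod (N i j : ℕ) :
    (cellMeasure N i).prod (cellMeasure N j) = volume.restrict (gridCell N i ×ˢ gridCell N j) := by
  rw [cellMeasure, cellMeasure, Measure.prod_restrict, Measure.volume_eq_prod]

theorem gridCell_subset {N i : ℕ} (hi : i < N) :
    gridCell N i ⊆ Set.Icc (-(1 : ℝ) / 2) (1 / 2) := by
  have hN : (0 : ℝ) < N := by exact_mod_cast Nat.zero_lt_of_lt hi
  have hi' : (i : ℝ) + 1 ≤ N := by exact_mod_cast hi
  refine Set.Icc_subset_Icc ?_ ?_
  · have : (0 : ℝ) ≤ (i : ℝ) / N := by positivity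
    linarith
  · have : ((i : ℝ) + 1) / N ≤ 1 := (div_le_one hN).2 hi'
    linarith

theorem cellMeasure_univ {N : ℕ} (i : ℕ) :
    cellMeasure N i Set.univ = ENNReal.ofReal (1 / N) := by
  rw [cellMeasure, Measure.restrict_apply_univ, gridCell, Real.volume_Icc]
  congr 1
  ring

theorem cellMeasure_Icc {N i : ℕ} (hi : i < N) :
    cellMeasure N i (Set.Icc (-(1 : ℝ) / 2) (1 / 2)) = ENNReal.ofReal (1 / N) := by
  rw [← cellMeasure_univ i, cellMeasure, Measure.restrict_apply_univ,
    Measure.restrict_apply measurableSet_Icc, Set.inter_eq_right.2 (gridCell_subset hi)]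

theorem restrict_Icc_add_restrict_Icc {a b c : ℝ} (hab : a ≤ b) (hbc : b ≤ c) :
    (volume.restrict (Set.Icc a b) + volume.restrict (Set.Icc b c) : Measure ℝ)
      = volume.restrict (Set.Icc a c) := by
  simp only [← Measure.restrict_congr_set (Ioc_ae_eq_Icc (α := ℝ) (μ := volume))]
  rw [← Set.Ioc_union_Ioc_eq_Ioc hab hbc,
    Measure.restrict_union (Set.Ioc_disjoint_Ioc_of_le le_rfl) measurableSet_Ioc]

theorem sum_cellMeasure {N : ℕ} (hN : 0 < N) :
    ∑ i ∈ Finset.range N, cellMeasure N i = volume.restrict (Set.Icc (-(1 : ℝ) / 2) (1 / 2)) := by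
  have hN' : (0 : ℝ) < N := by exact_mod_cast hN
  have key : ∀ n : ℕ, ∑ i ∈ Finset.range n, cellMeasure N i
      = volume.restrict (Set.Icc (-(1 : ℝ) / 2) (-(1 : ℝ) / 2 + (n : ℝ) / N)) := by
    intro n
    induction n with
    | zero => simp
    | succ n ih =>
      rw [Finset.sum_range_succ, ih, cellMeasure, gridCell, restrict_Icc_add_restrict_Icc]
      · push_cast
        rfl
      · have : (0 : ℝ) ≤ (n : ℝ) / N := by positivity
        linarith
      · gcongr
        linarith
  rw [key, div_self hN'.ne']
  norm_num

theorem sum_prod_cellMeasure {N : ℕ} (hN : 0 < N) :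
    ∑ i ∈ Finset.range N, ∑ j ∈ Finset.range N, (cellMeasure N i).prod (cellMeasure N j)
      = volume.restrict unitSq := by
  have hr : ∀ (μ : Measure ℝ) [SFinite μ] (n : ℕ),
      ∑ j ∈ Finset.range n, μ.prod (cellMeasure N j)
        = μ.prod (∑ j ∈ Finset.range n, cellMeasure N j) := by
    intro μ _ n
    induction n with
    | zero => simp
    | succ n ih => rw [Finset.sum_range_succ, ih, Finset.sum_range_succ, Measure.prod_add]
  have hl : ∀ (μ : Measure ℝ) [SFinite μ] (n : ℕ),
      ∑ j ∈ Finset.range n, (cellMeasure N j).prod μ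
        = (∑ j ∈ Finset.range n, cellMeasure N j).prod μ := by
    intro μ _ n
    induction n with
    | zero => simp
    | succ n ih => rw [Finset.sum_range_succ, ih, Finset.sum_range_succ, Measure.add_prod]
  simp only [hr, sum_cellMeasure hN]
  rw [hl, sum_cellMeasure hN, unitSq, Measure.prod_restrict, Measure.volume_eq_prod]

/-- The step function on the square with value `A i j` on the cell of index `(i, j)`. -/
def stepFun (N : ℕ) (A : ℕ → ℕ → ℝ) (p : ℝ × ℝ) : ℝ :=
  A ⌊N * (p.1 + 1 / 2)⌋₊ ⌊N * (p.2 + 1 / 2)⌋₊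

/-- The measure on the square with density `stepFun N A`. -/
def stepMeasure (N : ℕ) (A : ℕ → ℕ → ℝ) : Measure (ℝ × ℝ) :=
  (volume.restrict unitSq).withDensity fun p => ENNReal.ofReal (stepFun N A p)

theorem measurable_stepFun (N : ℕ) (A : ℕ → ℕ → ℝ) : Measurable (stepFun N A) := by
  have h : Measurable fun q : ℕ × ℕ => A q.1 q.2 := .of_discrete
  have h' : Measurable fun p : ℝ × ℝ => (⌊N * (p.1 + 1 / 2)⌋₊, ⌊N * (p.2 + 1 / 2)⌋₊) := by
    fun_prop
  exact h.comp h'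

theorem ae_cellMeasure_floor {N : ℕ} (hN : 0 < N) (i : ℕ) :
    ∀ᵐ x ∂cellMeasure N i, ⌊(N : ℝ) * (x + 1 / 2)⌋₊ = i := by
  have hN' : (0 : ℝ) < N := by exact_mod_cast hN
  rw [cellMeasure, gridCell, ← Measure.restrict_congr_set (Ico_ae_eq_Icc (α := ℝ) (μ := volume))]
  filter_upwards [ae_restrict_mem measurableSet_Ico] with x hx
  obtain ⟨h1, h2⟩ := hx
  have h1' : (i : ℝ) / N ≤ x + 1 / 2 := by linarith
  have h2' : x + 1 / 2 < ((i : ℝ) + 1) / N := by linarith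
  rw [div_le_iff₀' hN'] at h1'
  rw [lt_div_iff₀' hN'] at h2'
  exact (Nat.floor_eq_iff ((Nat.cast_nonneg i).trans h1')).2 ⟨h1', h2'⟩

theorem ae_stepFun {N : ℕ} (hN : 0 < N) (A : ℕ → ℕ → ℝ) (i j : ℕ) :
    ∀ᵐ p ∂(cellMeasure N i).prod (cellMeasure N j), stepFun N A p = A i j := by
  filter_upwards [Measure.quasiMeasurePreserving_fst.ae (ae_cellMeasure_floor hN i),
    Measure.quasiMeasurePreserving_snd.ae (ae_cellMeasure_floor hN j)] with p h1 h2
  rw [stepFun, h1, h2]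

theorem stepMeasure_eq_sum {N : ℕ} (hN : 0 < N) (A : ℕ → ℕ → ℝ) :
    stepMeasure N A = ∑ i ∈ Finset.range N, ∑ j ∈ Finset.range N,
      ENNReal.ofReal (A i j) • (cellMeasure N i).prod (cellMeasure N j) := by
  have hadd : ∀ (n : ℕ) (μ : ℕ → Measure (ℝ × ℝ)) (f : ℝ × ℝ → ℝ≥0∞),
      (∑ i ∈ Finset.range n, μ i).withDensity f
        = ∑ i ∈ Finset.range n, (μ i).withDensity f := by
    intro n μ f
    induction n with
    | zero => simp
    | succ n ih => rw [Finset.sum_range_succ, withDensity_add_measure, ih, Finset.sum_range_succ]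
  rw [stepMeasure, ← sum_prod_cellMeasure hN, hadd]
  refine Finset.sum_congr rfl fun i _ => ?_
  rw [hadd]
  refine Finset.sum_congr rfl fun j _ => ?_
  rw [← withDensity_const]
  refine withDensity_congr_ae ?_
  filter_upwards [ae_stepFun hN A i j] with p hp
  rw [hp]

theorem stepMeasure_prod {N : ℕ} (hN : 0 < N) (A : ℕ → ℕ → ℝ) (S T : Set ℝ) :
    stepMeasure N A (S ×ˢ T) = ∑ i ∈ Finset.range N, ∑ j ∈ Finset.range N,
      ENNReal.ofReal (A i j) * (cellMeasure N i S * cellMeasure N j T) := by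
  simp [stepMeasure_eq_sum hN, Measure.finsetSum_apply, Measure.prod_prod]

theorem isStepPermutonN_stepMeasure {N : ℕ} (hN : 0 < N) {A : ℕ → ℕ → ℝ}
    (hpos : ∀ i < N, ∀ j < N, 0 ≤ A i j) (hrow : ∀ i < N, ∑ j ∈ Finset.range N, A i j = N)
    (hcol : ∀ j < N, ∑ i ∈ Finset.range N, A i j = N) :
    IsStepPermutonN N (stepMeasure N A) := by
  have hN' : (0 : ℝ) < N := by exact_mod_cast hN
  have hmass : ∀ f : ℕ → ℝ, (∀ i < N, 0 ≤ f i) → ∑ i ∈ Finset.range N, f i = N →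
      ∑ i ∈ Finset.range N, ENNReal.ofReal (f i) * ENNReal.ofReal (1 / N) = 1 := by
    intro f hf hs
    rw [← Finset.sum_mul, ← ENNReal.ofReal_sum_of_nonneg fun i hi => hf i (Finset.mem_range.1 hi),
      hs, ← ENNReal.ofReal_mul hN'.le, mul_one_div_cancel hN'.ne', ENNReal.ofReal_one]
  have hfst : ∀ S, MeasurableSet S → stepMeasure N A (S ×ˢ Set.Icc (-(1 : ℝ) / 2) (1 / 2))
      = volume (S ∩ Set.Icc (-(1 : ℝ) / 2) (1 / 2)) := by
    intro S hS
    rw [stepMeasure_prod hN, ← Measure.restrict_apply hS, ← sum_cellMeasure hN,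
      Measure.finsetSum_apply]
    refine Finset.sum_congr rfl fun i hi => ?_
    rw [Finset.mem_range] at hi
    calc _ = ∑ j ∈ Finset.range N, ENNReal.ofReal (A i j) * ENNReal.ofReal (1 / N)
          * cellMeasure N i S := by
          refine Finset.sum_congr rfl fun j hj => ?_
          rw [cellMeasure_Icc (Finset.mem_range.1 hj)]
          ring
      _ = _ := by rw [← Finset.sum_mul, hmass _ (hpos i hi) (hrow i hi), one_mul]
  have hsnd : ∀ S, MeasurableSet S → stepMeasure N A (Set.Icc (-(1 : ℝ) / 2) (1 / 2) ×ˢ S)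
      = volume (S ∩ Set.Icc (-(1 : ℝ) / 2) (1 / 2)) := by
    intro S hS
    rw [stepMeasure_prod hN, ← Measure.restrict_apply hS, ← sum_cellMeasure hN,
      Measure.finsetSum_apply, Finset.sum_comm]
    refine Finset.sum_congr rfl fun j hj => ?_
    rw [Finset.mem_range] at hj
    calc _ = ∑ i ∈ Finset.range N, ENNReal.ofReal (A i j) * ENNReal.ofReal (1 / N)
          * cellMeasure N j S := by
          refine Finset.sum_congr rfl fun i hi => ?_
          rw [cellMeasure_Icc (Finset.mem_range.1 hi)]
          ring
      _ = _ := by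
          rw [← Finset.sum_mul, hmass _ (fun i hi => hpos i hi j hj) (hcol j hj), one_mul]
  have hcompl : stepMeasure N A unitSqᶜ = 0 := by
    refine withDensity_absolutelyContinuous _ _ ?_
    rw [Measure.restrict_apply measurableSet_unitSq.compl]
    simp
  refine ⟨⟨⟨?_⟩, hcompl, fun a b ha hab hb => ?_⟩, fun i hi j hj => ?_⟩
  · rw [← measure_add_measure_compl measurableSet_unitSq,
      hcompl, unitSq, hfst _ measurableSet_Icc]
    norm_num
  · have : Set.Icc a b ∩ Set.Icc (-(1 : ℝ) / 2) (1 / 2) = Set.Icc a b :=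
      Set.inter_eq_left.2 (Set.Icc_subset_Icc ha hb)
    rw [hfst _ measurableSet_Icc, hsnd _ measurableSet_Icc, this, Real.volume_Icc]
    exact ⟨rfl, rfl⟩
  · rw [Finset.mem_Icc] at hi hj
    obtain ⟨i, rfl⟩ := Nat.exists_eq_add_of_le' hi.1
    obtain ⟨j, rfl⟩ := Nat.exists_eq_add_of_le' hj.1
    refine ⟨ENNReal.ofReal (A i j), fun s hs hsm => ?_⟩
    rw [gridSq_succ] at hs
    have hsub : s ⊆ unitSq := hs.trans
      (Set.prod_mono (gridCell_subset (by omega)) (gridCell_subset (by omega)))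
    have hae : ∀ᵐ p ∂volume.restrict s, stepFun N A p = A i j := by
      have h := ae_stepFun hN A i j
      rw [cellMeasure_prod] at h
      exact ae_restrict_of_ae_restrict_of_subset hs h
    rw [stepMeasure, withDensity_apply _ hsm, Measure.restrict_restrict_of_subset hsub,
      lintegral_congr_ae (g := fun _ => ENNReal.ofReal (A i j)) ?_, setLIntegral_const]
    filter_upwards [hae] with p hp
    rw [hp]

theorem DKL_stepMeasure {N : ℕ} (hN : 0 < N) {A : ℕ → ℕ → ℝ}
    (hpos : ∀ i < N, ∀ j < N, 0 ≤ A i j) :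
    DKL (stepMeasure N A) (volume.restrict unitSq)
      = (((∑ i ∈ Finset.range N, ∑ j ∈ Finset.range N, A i j * Real.log (A i j)) / (N : ℝ) ^ 2 : ℝ)
        : EReal) := by
  have hc : ∀ i j, (fun p => stepFun N A p * Real.log (stepFun N A p))
      =ᵐ[(cellMeasure N i).prod (cellMeasure N j)] fun _ => A i j * Real.log (A i j) := by
    intro i j
    filter_upwards [ae_stepFun hN A i j] with p hp
    rw [hp]
  have hint : ∀ i j, Integrable (fun p => stepFun N A p * Real.log (stepFun N A p))
      ((cellMeasure N i).prod (cellMeasure N j)) := fun i j =>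
    (integrable_congr (hc i j)).2 (integrable_const _)
  have hint' : ∀ i ∈ Finset.range N,
      Integrable (fun p => stepFun N A p * Real.log (stepFun N A p))
        (∑ j ∈ Finset.range N, (cellMeasure N i).prod (cellMeasure N j)) := fun i _ =>
    integrable_finsetSum_measure.2 fun j _ => hint i j
  have hnonneg : ∀ᵐ p ∂volume.restrict unitSq, 0 ≤ stepFun N A p := by
    simp only [← sum_prod_cellMeasure hN, ae_finsetSum_measure_iff, Finset.mem_range]
    intro i hi j hj
    filter_upwards [ae_stepFun hN A i j] with p hp
    rw [hp]
    exact hpos i hi j hj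
  rw [stepMeasure, DKL_withDensity_ofReal (measurable_stepFun N A) hnonneg]
  · rw [← sum_prod_cellMeasure hN, integral_finsetSum_measure hint', Finset.sum_div]
    congr 1
    refine Finset.sum_congr rfl fun i _ => ?_
    rw [integral_finsetSum_measure fun j _ => hint i j, Finset.sum_div]
    refine Finset.sum_congr rfl fun j _ => ?_
    rw [integral_congr_ae (hc i j), integral_const, measureReal_def, ← Set.univ_prod_univ,
      Measure.prod_prod, cellMeasure_univ, cellMeasure_univ, ENNReal.toReal_mul,
      ENNReal.toReal_ofReal (by positivity), smul_eq_mul]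
    ring
  · rw [← sum_prod_cellMeasure hN]
    exact integrable_finsetSum_measure.2 hint'

/-- The tent function supported on `[-1, 1]`. -/
def tent (t : ℝ) : ℝ := max 0 (1 - |t|)

theorem tent_nonneg (t : ℝ) : 0 ≤ tent t := le_max_left _ _

theorem continuous_tent : Continuous tent := by
  unfold tent
  fun_prop

theorem tent_eq_zero {t : ℝ} (ht : 1 ≤ |t|) : tent t = 0 := max_eq_left (by linarith)

theorem sum_tent (n : ℕ) {t : ℝ} (ht : 0 ≤ t) :
    ∑ k ∈ Finset.range (n + 1), tent (t - k) = max 0 (min 1 (n + 1 - t)) := by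
  induction n with
  | zero =>
    simp only [zero_add, Finset.sum_range_one, Nat.cast_zero, sub_zero, tent, abs_of_nonneg ht]
    rw [min_eq_right (by linarith)]
  | succ n ih =>
    rw [Finset.sum_range_succ, ih, tent]
    push_cast
    rcases le_total t (n + 1) with h1 | h1
    · rw [abs_of_nonpos (by linarith), min_eq_left (by linarith : 1 ≤ (n : ℝ) + 1 + 1 - t),
        max_eq_right (by norm_num : (0 : ℝ) ≤ 1)]
      rcases le_total t n with h2 | h2
      · rw [min_eq_left (by linarith), max_eq_right zero_le_one, max_eq_left (by linarith),
          add_zero]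
      · rw [min_eq_right (by linarith), max_eq_right (by linarith), max_eq_right (by linarith)]
        ring
    · rw [abs_of_nonneg (by linarith), min_eq_right (by linarith),
        min_eq_right (by linarith : (n : ℝ) + 1 + 1 - t ≤ 1),
        max_eq_left (by linarith : (n : ℝ) + 1 - t ≤ 0), zero_add]
      congr 1
      ring

theorem sum_tent_eq_one {n : ℕ} {t : ℝ} (ht : 0 ≤ t) (htn : t ≤ n) :
    ∑ k ∈ Finset.range (n + 1), tent (t - k) = 1 := by
  rw [sum_tent n ht, min_eq_left (by linarith), max_eq_right zero_le_one]

theorem volume_gridCell_inter {N : ℕ} (hN : 0 < N) (i j : ℕ) (s : ℝ) :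
    volume (gridCell N i ∩ {y | -y + s ∈ gridCell N j})
      = ENNReal.ofReal (1 / N * tent (N * (s + 1) - (i + j + 1))) := by
  have hN' : (0 : ℝ) < N := by exact_mod_cast hN
  have hset : {y | -y + s ∈ gridCell N j} = Set.Icc (s - (-(1 : ℝ) / 2 + ((j : ℝ) + 1) / N))
      (s - (-(1 : ℝ) / 2 + (j : ℝ) / N)) := by
    ext y
    simp only [gridCell, Set.mem_ofPred_eq, Set.mem_Icc]
    constructor <;> rintro ⟨h1, h2⟩ <;> constructor <;> linarith
  set m := N * (s + 1) - (i + j + 1) with hm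
  have hs : s = -1 + (m + (i + j + 1)) / N := by
    rw [hm]
    field_simp
    ring
  rw [hset, gridCell, Set.Icc_inter_Icc, Real.volume_Icc]
  have e1 : -(1 : ℝ) / 2 + ((i : ℝ) + 1) / N = (-(1 : ℝ) / 2 + (i : ℝ) / N) + 1 / N := by ring
  have e2 : s - (-(1 : ℝ) / 2 + (j : ℝ) / N) = (-(1 : ℝ) / 2 + (i : ℝ) / N) + (m + 1) / N := by
    rw [hs]
    ring
  have e3 : s - (-(1 : ℝ) / 2 + ((j : ℝ) + 1) / N) = (-(1 : ℝ) / 2 + (i : ℝ) / N) + m / N := by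
    rw [hs]
    ring
  rw [e1, e2, e3]
  have hmul : 1 / (N : ℝ) * tent m = max 0 (1 / N * (1 - |m|)) := by
    rw [tent, mul_max_of_nonneg _ _ (by positivity), mul_zero]
  rw [hmul, ENNReal.ofReal_max, ENNReal.ofReal_zero, max_eq_right zero_le,
    min_add_add_left, add_sub_assoc]
  congr 1
  rcases le_total 0 m with h | h
  · have h' : 0 ≤ m / N := by positivity
    rw [abs_of_nonneg h, min_eq_left (by gcongr; linarith), max_eq_right (by linarith)]
    ring
  · have h' : m / N ≤ 0 := div_nonpos_of_nonpos_of_nonneg h hN'.le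
    rw [abs_of_nonpos h, min_eq_right (by gcongr; linarith), max_eq_left (by linarith)]
    ring

theorem map_add_prod_cellMeasure {N : ℕ} (hN : 0 < N) (i j : ℕ) :
    ((cellMeasure N i).prod (cellMeasure N j)).map (fun p => p.1 + p.2)
      = volume.withDensity
        fun s => ENNReal.ofReal (1 / N * tent (N * (s + 1) - (i + j + 1))) := by
  have hmeas : ∀ i, MeasurableSet (gridCell N i) := fun i => measurableSet_Icc
  change Measure.conv _ _ = _
  rw [cellMeasure, cellMeasure, ← withDensity_indicator_one (hmeas i),
    ← withDensity_indicator_one (hmeas j), conv_withDensity_eq_lconvolution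
      (measurable_one.indicator (hmeas i)) (measurable_one.indicator (hmeas j))]
  congr 1
  funext s
  rw [← volume_gridCell_inter hN, lconvolution_def, ← lintegral_indicator_one]
  · refine lintegral_congr fun y => ?_
    by_cases h1 : y ∈ gridCell N i <;> by_cases h2 : -y + s ∈ gridCell N j <;>
      simp [h1, h2]
  · exact (hmeas i).inter ((measurable_neg.add_const s) (hmeas j))

/-- The value at the `k`-th grid point of the density of the diagonal marginal of
`stepMeasure N A`. -/
def diagCoeff (N : ℕ) (A : ℕ → ℕ → ℝ) (k : ℕ) : ℝ :=
  (∑ i ∈ Finset.range N, if i ≤ k ∧ k - i < N then A i (k - i) else 0) / N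

/-- The density of the diagonal marginal of `stepMeasure N A`. -/
def diagDensity (N : ℕ) (A : ℕ → ℕ → ℝ) (s : ℝ) : ℝ :=
  ∑ k ∈ Finset.range (2 * N - 1), diagCoeff N A k * tent (N * (s + 1) - (k + 1))

theorem continuous_diagDensity (N : ℕ) (A : ℕ → ℕ → ℝ) : Continuous (diagDensity N A) := by
  unfold diagDensity
  exact continuous_finsetSum _ fun k _ =>
    continuous_const.mul (continuous_tent.comp (by fun_prop))

theorem diagCoeff_nonneg {N : ℕ} {A : ℕ → ℕ → ℝ} (hpos : ∀ i < N, ∀ j < N, 0 ≤ A i j) (k : ℕ) :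
    0 ≤ diagCoeff N A k := by
  refine div_nonneg (Finset.sum_nonneg fun i hi => ?_) (Nat.cast_nonneg N)
  split_ifs with h
  · exact hpos i (Finset.mem_range.1 hi) _ h.2
  · exact le_rfl

theorem diagDensity_nonneg {N : ℕ} {A : ℕ → ℕ → ℝ} (hpos : ∀ i < N, ∀ j < N, 0 ≤ A i j)
    (s : ℝ) : 0 ≤ diagDensity N A s :=
  Finset.sum_nonneg fun k _ => mul_nonneg (diagCoeff_nonneg hpos k) (tent_nonneg _)

theorem tent_grid_eq_zero {N k : ℕ} (hk : k < 2 * N - 1) {s : ℝ} (hs : s ∉ Set.Icc (-1 : ℝ) 1) :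
    tent (N * (s + 1) - (k + 1)) = 0 := by
  have hN : (0 : ℝ) < N := by exact_mod_cast (by omega : 0 < N)
  have hk' : (k : ℝ) + 2 ≤ 2 * N := by exact_mod_cast (by omega : k + 2 ≤ 2 * N)
  have hk0 : (0 : ℝ) ≤ k := Nat.cast_nonneg k
  apply tent_eq_zero
  rw [Set.mem_Icc, not_and_or, not_le, not_le] at hs
  rw [le_abs]
  rcases hs with hs | hs
  · right
    nlinarith
  · left
    nlinarith

theorem diagDensity_eq_zero {N : ℕ} {A : ℕ → ℕ → ℝ} {s : ℝ} (hs : s ∉ Set.Icc (-1 : ℝ) 1) :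
    diagDensity N A s = 0 :=
  Finset.sum_eq_zero fun k hk => by rw [tent_grid_eq_zero (Finset.mem_range.1 hk) hs, mul_zero]

theorem diagDensity_eq_sum (N : ℕ) (A : ℕ → ℕ → ℝ) (s : ℝ) :
    diagDensity N A s = ∑ i ∈ Finset.range N, ∑ j ∈ Finset.range N,
      A i j * (1 / N * tent (N * (s + 1) - (i + j + 1))) := by
  simp only [diagDensity, diagCoeff, Finset.sum_div, Finset.sum_mul]
  rw [Finset.sum_comm]
  refine Finset.sum_congr rfl fun i hi => ?_
  rw [Finset.mem_range] at hi
  simp only [ite_div, ite_mul, zero_div, zero_mul]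
  rw [← Finset.sum_filter]
  refine Finset.sum_nbij' (fun k => k - i) (fun j => i + j) ?_ ?_ ?_ ?_ ?_
  · intro k hk
    simp only [Finset.mem_filter, Finset.mem_range] at hk ⊢
    omega
  · intro j hj
    simp only [Finset.mem_filter, Finset.mem_range] at hj ⊢
    omega
  · intro k hk
    simp only [Finset.mem_filter, Finset.mem_range] at hk
    omega
  · intro j hj
    omega
  · intro k hk
    simp only [Finset.mem_filter, Finset.mem_range] at hk
    rw [Nat.cast_sub hk.2.1]
    ring_nf

theorem diagPlus_stepMeasure {N : ℕ} (hN : 0 < N) {A : ℕ → ℕ → ℝ}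
    (hpos : ∀ i < N, ∀ j < N, 0 ≤ A i j) :
    diagPlus (stepMeasure N A)
      = volume.withDensity fun s => ENNReal.ofReal (diagDensity N A s) := by
  have hadd : Measurable fun p : ℝ × ℝ => p.1 + p.2 := by fun_prop
  have htent : ∀ i j : ℕ, Measurable fun s : ℝ =>
      ENNReal.ofReal (1 / N * tent (N * (s + 1) - (i + j + 1))) := fun i j =>
    ((continuous_const.mul (continuous_tent.comp (by fun_prop))).measurable).ennreal_ofReal
  have hdens : ∀ s, ENNReal.ofReal (diagDensity N A s) = ∑ i ∈ Finset.range N,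
      ∑ j ∈ Finset.range N, ENNReal.ofReal (A i j)
        * ENNReal.ofReal (1 / N * tent (N * (s + 1) - (i + j + 1))) := by
    intro s
    have h0 : ∀ i ∈ Finset.range N, ∀ j ∈ Finset.range N,
        0 ≤ A i j * (1 / N * tent (N * (s + 1) - (i + j + 1))) := fun i hi j hj =>
      mul_nonneg (hpos i (Finset.mem_range.1 hi) j (Finset.mem_range.1 hj))
        (mul_nonneg (by positivity) (tent_nonneg _))
    rw [diagDensity_eq_sum, ENNReal.ofReal_sum_of_nonneg fun i hi => Finset.sum_nonneg (h0 i hi)]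
    refine Finset.sum_congr rfl fun i hi => ?_
    rw [ENNReal.ofReal_sum_of_nonneg (h0 i hi)]
    refine Finset.sum_congr rfl fun j hj => ?_
    rw [ENNReal.ofReal_mul (hpos i (Finset.mem_range.1 hi) j (Finset.mem_range.1 hj))]
  ext S hS
  simp only [hdens]
  rw [diagPlus, Measure.map_apply hadd hS, stepMeasure_eq_sum hN, withDensity_apply _ hS,
    Measure.finsetSum_apply, lintegral_finsetSum _ fun i _ => by
      exact Finset.measurable_fun_sum _ fun j _ => (htent i j).const_mul _]
  refine Finset.sum_congr rfl fun i _ => ?_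
  rw [Measure.finsetSum_apply, lintegral_finsetSum _ fun j _ => (htent i j).const_mul _]
  refine Finset.sum_congr rfl fun j _ => ?_
  rw [lintegral_const_mul _ (htent i j), ← withDensity_apply _ hS, ← map_add_prod_cellMeasure hN,
    Measure.map_apply hadd hS, Measure.smul_apply, smul_eq_mul]

theorem setIntegral_tent_grid {N k : ℕ} (hk : k < 2 * N - 1) :
    ∫ s in Set.Icc (-1 : ℝ) 1, tent (N * (s + 1) - (k + 1)) = 1 / N := by
  have hN : 0 < N := by omega
  have hN' : (0 : ℝ) < N := by exact_mod_cast hN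
  have hmass := congrArg (fun μ : Measure ℝ => μ Set.univ) (map_add_prod_cellMeasure hN k 0)
  beta_reduce at hmass
  rw [Measure.map_apply (by fun_prop) MeasurableSet.univ, Set.preimage_univ, ← Set.univ_prod_univ,
    Measure.prod_prod, cellMeasure_univ, cellMeasure_univ, withDensity_apply _ MeasurableSet.univ,
    Measure.restrict_univ] at hmass
  simp only [Nat.cast_zero, add_zero] at hmass
  have hint : ∫ s, 1 / (N : ℝ) * tent (N * (s + 1) - (k + 1)) = 1 / N * (1 / N) := by
    rw [integral_eq_lintegral_of_nonneg_ae
      (ae_of_all _ fun s => mul_nonneg (by positivity) (tent_nonneg _))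
      (continuous_const.mul (continuous_tent.comp (by fun_prop))).aestronglyMeasurable, ← hmass,
      ENNReal.toReal_mul, ENNReal.toReal_ofReal (by positivity)]
  rw [integral_const_mul] at hint
  rw [setIntegral_eq_integral_of_forall_compl_eq_zero fun s hs => tent_grid_eq_zero hk hs]
  exact mul_left_cancel₀ (by positivity) hint

theorem sum_range_two_mul_add_one {N : ℕ} (hN : 0 < N) (F : ℕ → ℝ) :
    ∑ k ∈ Finset.range (2 * N + 1), F k
      = F 0 + ∑ k ∈ Finset.range (2 * N - 1), F (k + 1) + F (2 * N) := by
  obtain ⟨M, hM⟩ : ∃ M, 2 * N = M + 1 := ⟨2 * N - 1, by omega⟩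
  rw [Finset.sum_range_succ, hM, Finset.sum_range_succ', Nat.add_sub_cancel]
  ring

/-- The values at the grid points of the density complementary to `diagDensity N A`. -/
def barCoeff (N : ℕ) (A : ℕ → ℕ → ℝ) (k : ℕ) : ℝ :=
  if k = 0 ∨ k = 2 * N then 1 else 1 - diagCoeff N A (k - 1)

theorem barCoeff_nonneg {N : ℕ} {A : ℕ → ℕ → ℝ}
    (hc : ∀ k < 2 * N - 1, diagCoeff N A k ≤ 1) {k : ℕ} (hk : k ∈ Finset.range (2 * N + 1)) :
    0 ≤ barCoeff N A k := by
  rw [Finset.mem_range] at hk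
  unfold barCoeff
  split_ifs with h
  · exact zero_le_one
  · exact sub_nonneg.2 (hc _ (by omega))

theorem barCoeff_succ {N : ℕ} (A : ℕ → ℕ → ℝ) {k : ℕ} (hk : k < 2 * N - 1) :
    barCoeff N A (k + 1) = 1 - diagCoeff N A k := by
  rw [barCoeff, if_neg (by omega), Nat.add_sub_cancel]

theorem grid_coordinate_mem (N : ℕ) {s : ℝ} (hs : s ∈ Set.Icc (-1 : ℝ) 1) :
    0 ≤ N * (s + 1) ∧ N * (s + 1) ≤ (2 * N : ℕ) := by
  have hN : (0 : ℝ) ≤ N := Nat.cast_nonneg N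
  obtain ⟨h1, h2⟩ := hs
  push_cast
  constructor <;> nlinarith

theorem one_sub_diagDensity {N : ℕ} (hN : 0 < N) (A : ℕ → ℕ → ℝ) {s : ℝ}
    (hs : s ∈ Set.Icc (-1 : ℝ) 1) :
    1 - diagDensity N A s
      = ∑ k ∈ Finset.range (2 * N + 1), tent (N * (s + 1) - k) * barCoeff N A k := by
  obtain ⟨h0, h1⟩ := grid_coordinate_mem N hs
  have hone := sum_tent_eq_one h0 h1
  rw [sum_range_two_mul_add_one hN] at hone
  have hsum : ∑ k ∈ Finset.range (2 * N - 1),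
      tent (N * (s + 1) - (k + 1 : ℕ)) * barCoeff N A (k + 1)
      = ∑ k ∈ Finset.range (2 * N - 1), tent (N * (s + 1) - (k + 1 : ℕ))
        - ∑ k ∈ Finset.range (2 * N - 1), diagCoeff N A k * tent (N * (s + 1) - (k + 1)) := by
    rw [← Finset.sum_sub_distrib]
    refine Finset.sum_congr rfl fun k hk => ?_
    rw [barCoeff_succ A (Finset.mem_range.1 hk)]
    push_cast
    ring
  have hz : barCoeff N A 0 = 1 := by simp [barCoeff]
  have he : barCoeff N A (2 * N) = 1 := by simp [barCoeff]
  rw [sum_range_two_mul_add_one hN, hsum, hz, he, diagDensity]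
  linarith

theorem one_sub_diagDensity_nonneg {N : ℕ} (hN : 0 < N) {A : ℕ → ℕ → ℝ}
    (hc : ∀ k < 2 * N - 1, diagCoeff N A k ≤ 1) {s : ℝ} (hs : s ∈ Set.Icc (-1 : ℝ) 1) :
    0 ≤ 1 - diagDensity N A s := by
  rw [one_sub_diagDensity hN A hs]
  exact Finset.sum_nonneg fun k hk => mul_nonneg (tent_nonneg _) (barCoeff_nonneg hc hk)

theorem mul_log_one_sub_diagDensity_le {N : ℕ} (hN : 0 < N) {A : ℕ → ℕ → ℝ}
    (hc : ∀ k < 2 * N - 1, diagCoeff N A k ≤ 1) {s : ℝ} (hs : s ∈ Set.Icc (-1 : ℝ) 1) :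
    (1 - diagDensity N A s) * Real.log (1 - diagDensity N A s)
      ≤ ∑ k ∈ Finset.range (2 * N - 1), tent (N * (s + 1) - (k + 1))
        * ((1 - diagCoeff N A k) * Real.log (1 - diagCoeff N A k)) := by
  obtain ⟨h0, h1⟩ := grid_coordinate_mem N hs
  have hJ := Real.convexOn_mul_log.map_sum_le (t := Finset.range (2 * N + 1))
    (w := fun k => tent (N * (s + 1) - k)) (p := barCoeff N A) (fun k _ => tent_nonneg _)
    (sum_tent_eq_one h0 h1) fun k hk => Set.mem_Ici.2 (barCoeff_nonneg hc hk)
  simp only [smul_eq_mul] at hJ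
  rw [← one_sub_diagDensity hN A hs, sum_range_two_mul_add_one hN] at hJ
  refine hJ.trans_eq ?_
  have hz : barCoeff N A 0 = 1 := by simp [barCoeff]
  have he : barCoeff N A (2 * N) = 1 := by simp [barCoeff]
  rw [hz, he, Real.log_one]
  simp only [mul_zero, zero_add, add_zero]
  refine Finset.sum_congr rfl fun k hk => ?_
  rw [barCoeff_succ A (Finset.mem_range.1 hk)]
  push_cast
  rfl

theorem diagPlus_stepMeasure_restrict {N : ℕ} (hN : 0 < N) {A : ℕ → ℕ → ℝ}
    (hpos : ∀ i < N, ∀ j < N, 0 ≤ A i j) :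
    diagPlus (stepMeasure N A) = (volume.restrict (Set.Icc (-1 : ℝ) 1)).withDensity
      fun s => ENNReal.ofReal (diagDensity N A s) := by
  rw [diagPlus_stepMeasure hN hpos, ← withDensity_indicator measurableSet_Icc]
  congr 1
  funext s
  by_cases hs : s ∈ Set.Icc (-1 : ℝ) 1
  · rw [Set.indicator_of_mem hs]
  · rw [Set.indicator_of_notMem hs, diagDensity_eq_zero hs, ENNReal.ofReal_zero]

/-- The measure complementary to the diagonal marginal of `stepMeasure N A`. -/
def barMeasure (N : ℕ) (A : ℕ → ℕ → ℝ) : Measure ℝ :=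
  (volume.restrict (Set.Icc (-1 : ℝ) 1)).withDensity
    fun s => ENNReal.ofReal (1 - diagDensity N A s)

theorem barMeasure_add_diagPlus {N : ℕ} (hN : 0 < N) {A : ℕ → ℕ → ℝ}
    (hpos : ∀ i < N, ∀ j < N, 0 ≤ A i j) (hc : ∀ k < 2 * N - 1, diagCoeff N A k ≤ 1) :
    barMeasure N A + diagPlus (stepMeasure N A) = volume.restrict (Set.Icc (-1 : ℝ) 1) := by
  have hm : Measurable fun s => ENNReal.ofReal (1 - diagDensity N A s) :=
    ((continuous_const.sub (continuous_diagDensity N A)).measurable).ennreal_ofReal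
  rw [barMeasure, diagPlus_stepMeasure_restrict hN hpos, ← withDensity_add_left hm]
  conv_rhs => rw [← withDensity_one (μ := volume.restrict (Set.Icc (-1 : ℝ) 1))]
  refine withDensity_congr_ae ?_
  filter_upwards [ae_restrict_mem measurableSet_Icc] with s hs
  rw [Pi.add_apply, ← ENNReal.ofReal_add (one_sub_diagDensity_nonneg hN hc hs)
    (diagDensity_nonneg hpos s)]
  simp

theorem setIntegral_diagDensity {N : ℕ} (hN : 0 < N) {A : ℕ → ℕ → ℝ}
    (hpos : ∀ i < N, ∀ j < N, 0 ≤ A i j) [IsProbabilityMeasure (stepMeasure N A)] :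
    ∫ s in Set.Icc (-1 : ℝ) 1, diagDensity N A s = 1 := by
  have h : diagPlus (stepMeasure N A) Set.univ = 1 := by
    rw [diagPlus, Measure.map_apply (by fun_prop) MeasurableSet.univ, Set.preimage_univ,
      measure_univ]
  rw [diagPlus_stepMeasure_restrict hN hpos, withDensity_apply _ MeasurableSet.univ,
    Measure.restrict_univ] at h
  rw [integral_eq_lintegral_of_nonneg_ae (ae_of_all _ fun s => diagDensity_nonneg hpos s)
    (continuous_diagDensity N A).aestronglyMeasurable, h, ENNReal.toReal_one]

theorem DKL_barMeasure_le {N : ℕ} (hN : 0 < N) {A : ℕ → ℕ → ℝ}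
    (hpos : ∀ i < N, ∀ j < N, 0 ≤ A i j) (hc : ∀ k < 2 * N - 1, diagCoeff N A k ≤ 1)
    [IsProbabilityMeasure (stepMeasure N A)] :
    DKL (barMeasure N A) unif11 ≤ ((Real.log 2 + (∑ k ∈ Finset.range (2 * N - 1),
      (1 - diagCoeff N A k) * Real.log (1 - diagCoeff N A k)) / N : ℝ) : EReal) := by
  have hcont : Continuous fun s => 1 - diagDensity N A s :=
    continuous_const.sub (continuous_diagDensity N A)
  have hI : ∀ {f : ℝ → ℝ}, Continuous f → IntegrableOn f (Set.Icc (-1 : ℝ) 1) := fun hf =>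
    hf.integrableOn_Icc
  have hlin : Continuous fun s => Real.log 2 * diagDensity N A s :=
    continuous_const.mul (continuous_diagDensity N A)
  have hsub : Continuous fun s => Real.log 2 - Real.log 2 * diagDensity N A s :=
    continuous_const.sub hlin
  have h2 : Continuous fun s => 2 * (1 - diagDensity N A s) := continuous_const.mul hcont
  have hlog2 : Continuous fun s =>
      2 * (1 - diagDensity N A s) * Real.log (2 * (1 - diagDensity N A s)) :=
    Real.continuous_mul_log.comp h2
  have hlog : Continuous fun s => (1 - diagDensity N A s) * Real.log (1 - diagDensity N A s) :=
    Real.continuous_mul_log.comp hcont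
  have hbar : barMeasure N A
      = unif11.withDensity fun s => ENNReal.ofReal (2 * (1 - diagDensity N A s)) := by
    rw [unif11, withDensity_smul_measure, ← withDensity_smul' _ _ (by simp), barMeasure]
    congr 1
    funext s
    rw [Pi.smul_apply, smul_eq_mul, ENNReal.ofReal_mul (by norm_num), ← mul_assoc]
    simp [ENNReal.inv_mul_cancel]
  have hfin : SigmaFinite unif11 := by
    have : IsFiniteMeasure unif11 := by
      unfold unif11
      exact Measure.smul_finite _ (by simp)
    infer_instance
  rw [hbar, DKL_withDensity_ofReal h2.measurable ?_ ?_]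
  · rw [EReal.coe_le_coe_iff, unif11, integral_smul_measure]
    have hpt : ∀ s, 2 * (1 - diagDensity N A s) * Real.log (2 * (1 - diagDensity N A s))
        = 2 * ((Real.log 2 - Real.log 2 * diagDensity N A s)
          + (1 - diagDensity N A s) * Real.log (1 - diagDensity N A s)) := by
      intro s
      by_cases h : 1 - diagDensity N A s = 0
      · simp only [h]
        linear_combination (-(2 * Real.log 2)) * h
      · rw [Real.log_mul two_ne_zero h]
        ring
    simp only [hpt]
    rw [integral_const_mul, integral_add (hI hsub) (hI hlog),
      integral_sub (hI continuous_const) (hI hlin),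
      integral_const_mul, setIntegral_diagDensity hN hpos]
    have hJ : ∫ s in Set.Icc (-1 : ℝ) 1,
        (1 - diagDensity N A s) * Real.log (1 - diagDensity N A s)
        ≤ (∑ k ∈ Finset.range (2 * N - 1),
          (1 - diagCoeff N A k) * Real.log (1 - diagCoeff N A k)) / N := by
      have hterm : ∀ k ∈ Finset.range (2 * N - 1), IntegrableOn (fun s =>
          tent (N * (s + 1) - (k + 1))
            * ((1 - diagCoeff N A k) * Real.log (1 - diagCoeff N A k))) (Set.Icc (-1 : ℝ) 1) :=
        fun k _ => hI ((continuous_tent.comp (by fun_prop)).mul continuous_const)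
      refine (setIntegral_mono_on (hI hlog) (integrable_finsetSum _ hterm) measurableSet_Icc
        fun s hs => mul_log_one_sub_diagDensity_le hN hc hs).trans_eq ?_
      rw [integral_finsetSum _ hterm, Finset.sum_div]
      refine Finset.sum_congr rfl fun k hk => ?_
      rw [integral_mul_const, setIntegral_tent_grid (Finset.mem_range.1 hk)]
      ring
    simp
    linarith
  · refine Measure.ae_smul_measure ?_ _
    filter_upwards [ae_restrict_mem measurableSet_Icc] with s hs
    exact mul_nonneg zero_le_two (one_sub_diagDensity_nonneg hN hc hs)
  · exact (hI hlog2).smul_measure (by simp)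

theorem map_neg_cellMeasure {N i : ℕ} (hi : i < N) :
    (cellMeasure N i).map (fun x => -x) = cellMeasure N (N - 1 - i) := by
  have hN : (0 : ℝ) < N := by exact_mod_cast Nat.zero_lt_of_lt hi
  have hset : (fun x : ℝ => -x) ⁻¹' gridCell N (N - 1 - i) = gridCell N i := by
    have hcast : ((N - 1 - i : ℕ) : ℝ) = N - 1 - i := by
      rw [Nat.cast_sub (by omega), Nat.cast_sub (by omega), Nat.cast_one]
    have e1 : ((N : ℝ) - 1 - i) / N = 1 - (i + 1) / N := by
      field_simp
      ring
    have e2 : ((N : ℝ) - 1 - i + 1) / N = 1 - i / N := by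
      field_simp
      ring
    ext x
    simp only [gridCell, Set.mem_preimage, Set.mem_Icc, hcast, e1, e2]
    constructor <;> rintro ⟨h1, h2⟩ <;> constructor <;> linarith
  rw [cellMeasure, cellMeasure, ← hset]
  exact ((Measure.measurePreserving_neg (volume : Measure ℝ)).restrict_preimage
    measurableSet_Icc).map_eq

theorem map_reflect_stepMeasure {N : ℕ} (hN : 0 < N) {A : ℕ → ℕ → ℝ}
    (hrev : ∀ i < N, ∀ j < N, A (N - 1 - i) j = A i j) :
    (stepMeasure N A).map (fun p => (-p.1, p.2)) = stepMeasure N A := by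
  have hf : Measurable fun p : ℝ × ℝ => (-p.1, p.2) := by fun_prop
  have hmap : ∀ i < N, ∀ j, ((cellMeasure N i).prod (cellMeasure N j)).map (fun p => (-p.1, p.2))
      = (cellMeasure N (N - 1 - i)).prod (cellMeasure N j) := by
    intro i hi j
    have h := Measure.map_prod_map (cellMeasure N i) (cellMeasure N j) measurable_neg measurable_id
    rw [Measure.map_id, show (Neg.neg : ℝ → ℝ) = fun x => -x from rfl, map_neg_cellMeasure hi] at h
    exact h.symm
  ext S hS
  rw [Measure.map_apply hf hS, stepMeasure_eq_sum hN]
  simp only [Measure.finsetSum_apply, Measure.smul_apply, smul_eq_mul]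
  rw [← Finset.sum_range_reflect]
  refine Finset.sum_congr rfl fun i hi => Finset.sum_congr rfl fun j hj => ?_
  rw [Finset.mem_range] at hi hj
  rw [hrev i hi j hj, ← Measure.map_apply hf hS, hmap _ (by omega),
    show N - 1 - (N - 1 - i) = i by omega]

theorem diagMinus_stepMeasure {N : ℕ} (hN : 0 < N) {A : ℕ → ℕ → ℝ}
    (hrev : ∀ i < N, ∀ j < N, A (N - 1 - i) j = A i j) :
    diagMinus (stepMeasure N A) = diagPlus (stepMeasure N A) := by
  conv_rhs => rw [← map_reflect_stepMeasure hN hrev]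
  rw [diagPlus, Measure.map_map (by fun_prop) (by fun_prop), diagMinus]
  congr 1
  funext p
  simp only [Function.comp_apply]
  ring

theorem barPlus_stepMeasure {N : ℕ} (hN : 0 < N) {A : ℕ → ℕ → ℝ}
    (hpos : ∀ i < N, ∀ j < N, 0 ≤ A i j) (hc : ∀ k < 2 * N - 1, diagCoeff N A k ≤ 1)
    [IsProbabilityMeasure (stepMeasure N A)] :
    barPlus (stepMeasure N A) = barMeasure N A := by
  have : IsFiniteMeasure (diagPlus (stepMeasure N A)) := by
    unfold diagPlus
    infer_instance
  rw [barPlus, ← barMeasure_add_diagPlus hN hpos hc, Measure.add_sub_cancel]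

theorem subUniformDiag_stepMeasure {N : ℕ} (hN : 0 < N) {A : ℕ → ℕ → ℝ}
    (hpos : ∀ i < N, ∀ j < N, 0 ≤ A i j) (hc : ∀ k < 2 * N - 1, diagCoeff N A k ≤ 1)
    (hrev : ∀ i < N, ∀ j < N, A (N - 1 - i) j = A i j) :
    SubUniformDiag (stepMeasure N A) := by
  have hle : diagPlus (stepMeasure N A) ≤ volume := by
    refine le_trans ?_ (Measure.restrict_le_self (s := Set.Icc (-1 : ℝ) 1))
    rw [← barMeasure_add_diagPlus hN hpos hc]
    exact Measure.le_add_left le_rfl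
  intro a b _ _ _
  rw [← Real.volume_Icc]
  constructor
  · refine le_trans ?_ (hle (Set.Icc a b))
    rw [diagPlus, Measure.map_apply (by fun_prop) measurableSet_Icc]
    exact measure_mono fun p hp => hp.2
  · refine le_trans ?_ (hle (Set.Icc a b))
    rw [← diagMinus_stepMeasure hN hrev, diagMinus,
      Measure.map_apply (by fun_prop) measurableSet_Icc]
    exact measure_mono fun p hp => hp.2

theorem le_Hq_stepMeasure {N : ℕ} (hN : 0 < N) {A : ℕ → ℕ → ℝ}
    (hpos : ∀ i < N, ∀ j < N, 0 ≤ A i j) (hc : ∀ k < 2 * N - 1, diagCoeff N A k ≤ 1)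
    (hrev : ∀ i < N, ∀ j < N, A (N - 1 - i) j = A i j)
    [IsProbabilityMeasure (stepMeasure N A)] :
    ((-((∑ i ∈ Finset.range N, ∑ j ∈ Finset.range N, A i j * Real.log (A i j)) / (N : ℝ) ^ 2
      + 2 * ((∑ k ∈ Finset.range (2 * N - 1),
          (1 - diagCoeff N A k) * Real.log (1 - diagCoeff N A k)) / N) + 3) : ℝ) : EReal)
      ≤ Hq (stepMeasure N A) := by
  have hminus : barMinus (stepMeasure N A) = barMeasure N A := by
    rw [barMinus, diagMinus_stepMeasure hN hrev]
    exact barPlus_stepMeasure hN hpos hc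
  have hbar := DKL_barMeasure_le hN hpos hc
  rw [Hq, hminus, barPlus_stepMeasure hN hpos hc, DKL_stepMeasure hN hpos]
  refine le_trans (le_of_eq ?_)
    (add_le_add (EReal.sub_le_sub (EReal.sub_le_sub le_rfl hbar) hbar) le_rfl)
  norm_cast
  ring

theorem diagCoeff_gridDensity (k : ℕ) :
    1 - diagCoeff 50 (fun i j => (gridDensity i j : ℝ)) k = (diagDeficit k : ℝ) := by
  rw [diagCoeff, diagDeficit]
  push_cast
  simp only [apply_ite (Rat.cast : ℚ → ℝ), Rat.cast_zero]

theorem sum_gridDensity (i : ℕ) : ∑ j ∈ Finset.range 50, (gridDensity i j : ℝ) = 50 := by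
  have h : ∑ j ∈ Finset.range 50, (profile j : ℝ) = 0 := by exact_mod_cast sum_profile
  simp only [gridDensity]
  push_cast
  rw [Finset.sum_sub_distrib, ← Finset.sum_div, ← Finset.mul_sum, h]
  simp

theorem gridDensity_comm (i j : ℕ) : gridDensity i j = gridDensity j i := by
  rw [gridDensity, gridDensity, mul_comm]

theorem entropy_gridDensity_le :
    (∑ i ∈ Finset.range 50, ∑ j ∈ Finset.range 50,
        (gridDensity i j : ℝ) * Real.log (gridDensity i j)) / 2500
      + 2 * ((∑ k ∈ Finset.range 99, (diagDeficit k : ℝ) * Real.log (diagDeficit k)) / 50) + 3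
      ≤ 1.9449 := by
  have hmul : ∀ {t : ℚ}, 0 < t → (t : ℝ) * Real.log t ≤ (t : ℝ) * (logUpper t : ℝ) := fun ht =>
    mul_le_mul_of_nonneg_left (log_le_logUpper ht) (by exact_mod_cast ht.le)
  have h : ((((∑ i ∈ Finset.range 50, ∑ j ∈ Finset.range 50,
      gridDensity i j * logUpper (gridDensity i j)) / 2500
      + 2 * ((∑ k ∈ Finset.range 99, diagDeficit k * logUpper (diagDeficit k)) / 50) + 3 : ℚ)) : ℝ)
      ≤ ((1.9449 : ℚ) : ℝ) := by
    exact_mod_cast entropy_rat_le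
  refine le_trans ?_ (h.trans_eq (by norm_num))
  push_cast
  gcongr ?_ / 2500 + 2 * (?_ / 50) + 3
  · exact Finset.sum_le_sum fun i hi => Finset.sum_le_sum fun j hj =>
      hmul (gridDensity_pos i (Finset.mem_range.1 hi) j (Finset.mem_range.1 hj))
  · exact Finset.sum_le_sum fun k hk => hmul (diagDeficit_pos k (Finset.mem_range.1 hk))

theorem exists_mem_queenons_le_Hq :
    ∃ γ ∈ queenons, ((-1.9449 : ℝ) : EReal) ≤ Hq (γ : ProbabilityMeasure (ℝ × ℝ)).toMeasure := by
  let A : ℕ → ℕ → ℝ := fun i j => gridDensity i j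
  have hN : 0 < 50 := by norm_num
  have hpos : ∀ i < 50, ∀ j < 50, 0 ≤ A i j := fun i hi j hj => by
    simp only [A]
    exact_mod_cast (gridDensity_pos i hi j hj).le
  have hc : ∀ k < 2 * 50 - 1, diagCoeff 50 A k ≤ 1 := fun k hk => by
    have h0 : (0 : ℝ) < diagDeficit k := by exact_mod_cast diagDeficit_pos k hk
    rw [← diagCoeff_gridDensity] at h0
    exact (sub_pos.1 h0).le
  have hrev : ∀ i < 50, ∀ j < 50, A (50 - 1 - i) j = A i j := fun i hi j _ => by
    simp only [A, gridDensity, Nat.add_one_sub_one, profile_rev i hi]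
  have hstep : IsStepPermutonN 50 (stepMeasure 50 A) := by
    refine isStepPermutonN_stepMeasure hN hpos (fun i _ => ?_) fun j _ => ?_
    · exact (sum_gridDensity i).trans (by norm_num)
    · simp only [A, gridDensity_comm _ j]
      exact (sum_gridDensity j).trans (by norm_num)
  have hprob : IsProbabilityMeasure (stepMeasure 50 A) := hstep.1.1
  refine ⟨⟨stepMeasure 50 A, hprob⟩, subset_closure
    ⟨⟨50, hN, hstep⟩, subUniformDiag_stepMeasure hN hpos hc hrev⟩, ?_⟩
  refine le_trans ?_ (le_Hq_stepMeasure hN hpos hc hrev)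
  rw [EReal.coe_le_coe_iff]
  simp only [A, diagCoeff_gridDensity]
  have h := entropy_gridDensity_le
  norm_num at h ⊢
  linarith

/-- **Claim (explicit bounds on `H_q(γ*)`).**
If `γ*` maximizes `H_q` on `Γ`, then `−1.9449 ≤ H_q(γ*) ≤ −1.94`. -/
theorem Hq_max_bounds (γstar : ProbabilityMeasure (ℝ × ℝ)) (hγstar : γstar ∈ queenons)
    (hmax : ∀ γ ∈ queenons,
      Hq (γ : ProbabilityMeasure (ℝ × ℝ)).toMeasure ≤ Hq γstar.toMeasure) :
    ((-1.9449 : ℝ) : EReal) ≤ Hq γstar.toMeasure ∧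
      Hq γstar.toMeasure ≤ ((-1.94 : ℝ) : EReal) := by
  obtain ⟨γ, hγ, hle⟩ := exists_mem_queenons_le_Hq
  exact ⟨hle.trans (hmax γ hγ), Hq_le_of_mem_queenons hγstar⟩

end
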